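/- arXiv:2511.06784 — 2 statements merged into one kernel-verified Lean document; each statement's English description precedes it below -/
import Mathlib

section
/- Let k ≥ 3 and d ≥ 3 be integers, and let π_1, …, π_k be k nontrivial partitions of d such that ∑_{i=1}^{k} (d − |π_i|) = 2d − 2 and |π_i| ≥ |π_k| for all i = 1, …, k. If k ≥ |π_k| + 2, then the collection D = {π_1, …, π_k} is realizable; that is, there exist permutations α_1, …, α_k of {1, …, d} such that the cycle type of α_i (counting fixed points as parts equal to 1) is π_i for each i, the product α_1 ⋯ α_k is the identity, and the subgroup generated by α_1, …, α_k acts transitively on {1, …, d}. -/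
/-- The cycle type of a permutation of `Fin d`, counting fixed points as parts equal to `1`. -/
def fullCycleType {d : ℕ} (σ : Equiv.Perm (Fin d)) : Multiset ℕ :=
  σ.cycleType + Multiset.replicate (d - σ.cycleType.sum) 1

/-- A collection `π 0, …, π (k-1)` of partitions of `d` is realizable if there are permutations
of `{1, …, d}` with these cycle types (fixed points counted as parts `1`), whose product is the
identity, and which generate a subgroup acting transitively. -/
def realizable (d k : ℕ) (π : Fin k → Multiset ℕ) : Prop :=
  ∃ α : Fin k → Equiv.Perm (Fin d),
    (∀ i, fullCycleType (α i) = π i) ∧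
    (List.ofFn α).prod = 1 ∧
    ∀ x y : Fin d, ∃ g ∈ Subgroup.closure (Set.range α), g x = y

namespace Hurwitz

open Equiv Equiv.Perm

section CycleType

variable {V W : Type} [Fintype V] [DecidableEq V] [Fintype W] [DecidableEq W]

/-- The length of the cycle of `σ` through `u` (equal to `1` for fixed points). -/
def len (σ : Perm V) (u : V) : ℕ := (Finset.univ.filter fun v => σ.SameCycle u v).card

/-- The cycle type of a permutation, with fixed points counted as parts equal to `1`. -/
def ct (σ : Perm V) : Multiset ℕ :=
  σ.cycleType + Multiset.replicate (Fintype.card V - σ.cycleType.sum) 1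

/-- The number of points lying on cycles of length `n`. -/
def cnt (σ : Perm V) (n : ℕ) : ℕ := ∑ u, if len σ u = n then 1 else 0

lemma sameCycle_induction {V : Type} [Fintype V] {σ : Perm V} {u w : V} (P : V → Prop) (h0 : P u)
    (hs : ∀ v, P v → P (σ v)) (h : σ.SameCycle u w) : P w := by
  obtain ⟨i, -, rfl⟩ := h.exists_pow_eq'
  clear h
  induction i with
  | zero => simpa
  | succ n ih => rw [pow_succ', Perm.mul_apply]; exact hs _ ih

lemma len_pos (σ : Perm V) (u : V) : 0 < len σ u :=
  Finset.card_pos.2 ⟨u, by simp [SameCycle.refl]⟩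

lemma len_eq_of_sameCycle {σ : Perm V} {u v : V} (h : σ.SameCycle u v) : len σ u = len σ v := by
  unfold len
  congr 1
  ext w
  simp only [Finset.mem_filter, Finset.mem_univ, true_and]
  exact ⟨fun k => h.symm.trans k, fun k => h.trans k⟩

lemma len_of_fixed {σ : Perm V} {u : V} (h : σ u = u) : len σ u = 1 := by
  unfold len
  rw [Finset.card_eq_one]
  refine ⟨u, ?_⟩
  ext w
  simp only [Finset.mem_filter, Finset.mem_univ, true_and, Finset.mem_singleton]
  refine ⟨fun k => ?_, fun k => k ▸ SameCycle.refl _ _⟩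
  exact sameCycle_induction (fun v => v = u) rfl (fun v hv => by rw [hv, h]) k

lemma len_of_not_fixed {σ : Perm V} {u : V} (h : σ u ≠ u) :
    len σ u = (σ.cycleOf u).support.card := by
  unfold len
  congr 1
  ext w
  rw [mem_support_cycleOf_iff]
  simp [h]

lemma cnt_eq (σ : Perm V) (n : ℕ) : cnt σ n = n * (ct σ).count n := by
  have hsum : σ.cycleType.sum = σ.support.card := sum_cycleType σ
  have hcard : cnt σ n = (Finset.univ.filter fun u => len σ u = n).card := by
    simp [cnt]
  have h01 : ∀ m ∈ σ.cycleType, 2 ≤ m := fun m hm => two_le_of_mem_cycleType hm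
  rcases Nat.lt_or_ge n 2 with hn | hn
  · have h0 : σ.cycleType.count n = 0 :=
      Multiset.count_eq_zero.2 fun hm => by have := h01 _ hm; omega
    interval_cases n
    · rw [hcard, zero_mul, Finset.card_eq_zero, Finset.filter_eq_empty_iff]
      exact fun u _ => (len_pos σ u).ne'
    · rw [hcard, ct, Multiset.count_add, h0, Multiset.count_replicate_self, hsum, one_mul, zero_add,
        ← Finset.card_compl]
      congr 1
      ext u
      simp only [Finset.mem_filter, Finset.mem_univ, true_and, Finset.mem_compl, mem_support,
        not_not]
      refine ⟨fun h => ?_, len_of_fixed⟩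
      by_contra hu
      rw [len_of_not_fixed hu] at h
      have := (isCycle_cycleOf σ hu).two_le_card_support
      omega
  · have h1 : (Multiset.replicate (Fintype.card V - σ.cycleType.sum) 1).count n = 0 :=
      Multiset.count_eq_zero.2 fun hm => by have := Multiset.eq_of_mem_replicate hm; omega
    have h2 : (Finset.univ.filter fun u => len σ u = n) =
        (σ.cycleFactorsFinset.filter fun c => c.support.card = n).biUnion fun c => c.support := by
      ext u
      simp only [Finset.mem_filter, Finset.mem_univ, true_and, Finset.mem_biUnion]
      constructor
      · intro h
        have hu : σ u ≠ u := fun hu => by rw [len_of_fixed hu] at h; omega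
        refine ⟨σ.cycleOf u, ⟨cycleOf_mem_cycleFactorsFinset_iff.2 (mem_support.2 hu), ?_⟩, ?_⟩
        · rw [← len_of_not_fixed hu, h]
        · simp [hu]
      · rintro ⟨c, ⟨hc, hcn⟩, huc⟩
        have hu : σ u ≠ u := mem_support.1 (mem_cycleFactorsFinset_support_le hc huc)
        rw [len_of_not_fixed hu, ← cycle_is_cycleOf huc hc, hcn]
    rw [hcard, ct, Multiset.count_add, h1, add_zero, h2, Finset.card_biUnion]
    · rw [Finset.sum_congr rfl (g := fun _ => n) (fun c hc => (Finset.mem_filter.1 hc).2),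
        Finset.sum_const, smul_eq_mul, mul_comm, cycleType_def, Multiset.count_map]
      congr 1
      simp only [Finset.card_def, Finset.filter_val, Function.comp, eq_comm]
      congr!
    · intro c hc e he hce
      have := σ.cycleFactorsFinset_pairwise_disjoint (Finset.mem_filter.1 hc).1
        (Finset.mem_filter.1 he).1 hce
      exact this.disjoint_support

lemma one_le_of_mem_ct {σ : Perm V} {n : ℕ} (h : n ∈ ct σ) : 1 ≤ n := by
  rcases Multiset.mem_add.1 h with h | h
  · have := two_le_of_mem_cycleType h; omega
  · exact (Multiset.eq_of_mem_replicate h).ge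

lemma ct_sum (σ : Perm V) : (ct σ).sum = Fintype.card V := by
  have : σ.cycleType.sum ≤ Fintype.card V := by
    rw [sum_cycleType]; exact Finset.card_le_univ _
  simp only [ct, Multiset.sum_add, Multiset.sum_replicate, smul_eq_mul, mul_one]
  omega

lemma ct_eq_of_cnt {σ : Perm V} {M : Multiset ℕ} (h0 : 0 ∉ M)
    (h : ∀ n, cnt σ n = n * M.count n) : ct σ = M := by
  ext n
  rcases Nat.eq_zero_or_pos n with rfl | hn
  · rw [Multiset.count_eq_zero.2 h0, Multiset.count_eq_zero.2]
    exact fun h => by have := one_le_of_mem_ct h; omega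
  · exact Nat.eq_of_mul_eq_mul_left hn (by rw [← cnt_eq, h])

lemma exists_len_eq {σ : Perm V} {n : ℕ} (h : n ∈ ct σ) : ∃ u, len σ u = n := by
  by_contra hc
  push Not at hc
  have h1 : cnt σ n = 0 := by simp [cnt, hc]
  rw [cnt_eq] at h1
  have := one_le_of_mem_ct h
  have := Multiset.count_pos.2 h
  have := Nat.mul_pos (by omega : 0 < n) this
  omega

lemma len_mem_ct (σ : Perm V) (u : V) : len σ u ∈ ct σ := by
  rw [← Multiset.count_pos]
  have h1 : 0 < cnt σ (len σ u) := by
    unfold cnt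
    exact Finset.sum_pos' (fun _ _ => Nat.zero_le _) ⟨u, Finset.mem_univ _, by simp⟩
  rw [cnt_eq] at h1
  exact Nat.pos_of_mul_pos_left h1

lemma sameCycle_map_iff {V W : Type} [Fintype V] [Fintype W] {σ : Perm V} {τ : Perm W}
    {f : V → W} (h : ∀ u, f (σ u) = τ (f u)) (u : V) (w : W) :
    τ.SameCycle (f u) w ↔ ∃ v, σ.SameCycle u v ∧ f v = w := by
  constructor
  · intro k
    refine sameCycle_induction (fun w => ∃ v, σ.SameCycle u v ∧ f v = w)
      ⟨u, SameCycle.refl _ _, rfl⟩ ?_ k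
    rintro _ ⟨v, hv, rfl⟩
    exact ⟨σ v, sameCycle_apply_right.2 hv, h v⟩
  · rintro ⟨v, hv, rfl⟩
    exact sameCycle_induction (fun v => τ.SameCycle (f u) (f v)) (SameCycle.refl _ _)
      (fun v hv => by rw [h]; exact sameCycle_apply_right.2 hv) hv

lemma len_map {σ : Perm V} {τ : Perm W} {f : V → W} (hf : Function.Injective f)
    (h : ∀ u, f (σ u) = τ (f u)) (u : V) : len τ (f u) = len σ u := by
  unfold len
  rw [← Finset.card_image_of_injective _ hf]
  congr 1
  ext w
  simp [sameCycle_map_iff h]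

lemma ct_map {σ : Perm V} {τ : Perm W} (e : V ≃ W) (h : ∀ u, e (σ u) = τ (e u)) :
    ct τ = ct σ := by
  refine ct_eq_of_cnt (fun h => by have := one_le_of_mem_ct h; omega) fun n => ?_
  rw [← cnt_eq]
  unfold cnt
  rw [← Equiv.sum_comp e]
  simp [len_map e.injective h]

lemma ct_conj (g σ : Perm V) : ct (g * σ * g⁻¹) = ct σ :=
  ct_map g fun u => by simp

lemma len_conj (g σ : Perm V) (u : V) : len (g * σ * g⁻¹) (g u) = len σ u :=
  len_map g.injective (fun u => by simp) u

lemma len_inv (σ : Perm V) (u : V) : len σ⁻¹ u = len σ u := by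
  simp [len, sameCycle_inv]

lemma ct_inv (σ : Perm V) : ct σ⁻¹ = ct σ := by
  simp [ct, cycleType_inv]

lemma ct_one : ct (1 : Perm V) = Multiset.replicate (Fintype.card V) 1 := by
  simp [ct]

lemma exists_conj_of_ct_eq {σ τ : Perm V} (h : ct σ = ct τ) : ∃ g : Perm V, g * σ * g⁻¹ = τ := by
  have hc : σ.cycleType = τ.cycleType := by
    ext n
    rcases Nat.lt_or_ge n 2 with hn | hn
    · rw [Multiset.count_eq_zero.2 fun h => ?_, Multiset.count_eq_zero.2 fun h => ?_] <;>
      · have := two_le_of_mem_cycleType h; omega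
    · have := congrArg (Multiset.count n) h
      simpa [ct, Multiset.count_replicate, show ¬ 1 = n by omega] using this
  exact isConj_iff.1 ((isConj_iff_cycleType_eq).2 hc)

lemma len_sumCongr_inl (σ : Perm V) (τ : Perm W) (u : V) :
    len (Equiv.sumCongr σ τ : Perm (V ⊕ W)) (Sum.inl u) = len σ u :=
  len_map Sum.inl_injective (fun u => by simp) u

lemma len_sumCongr_inr (σ : Perm V) (τ : Perm W) (u : W) :
    len (Equiv.sumCongr σ τ : Perm (V ⊕ W)) (Sum.inr u) = len τ u :=
  len_map Sum.inr_injective (fun u => by simp) u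

lemma ct_sumCongr (σ : Perm V) (τ : Perm W) :
    ct (Equiv.sumCongr σ τ : Perm (V ⊕ W)) = ct σ + ct τ := by
  refine ct_eq_of_cnt (fun h => ?_) fun n => ?_
  · rcases Multiset.mem_add.1 h with h | h <;> · have := one_le_of_mem_ct h; omega
  · rw [Multiset.count_add, mul_add, ← cnt_eq, ← cnt_eq]
    unfold cnt
    rw [Fintype.sum_sum_type]
    simp only [len_sumCongr_inl, len_sumCongr_inr]

lemma not_sameCycle_sumCongr {V W : Type} [Fintype V] [Fintype W] (σ : Perm V) (τ : Perm W)
    (u : V) (w : W) :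
    ¬ Equiv.Perm.SameCycle (Equiv.sumCongr σ τ : Perm (V ⊕ W)) (Sum.inl u) (Sum.inr w) := by
  rw [sameCycle_map_iff (σ := σ) (f := Sum.inl) (by simp)]
  simp

section Merge

variable {σ : Perm V} {s t : V}

lemma sameCycle_mul_swap (hst : ¬ σ.SameCycle s t) : (σ * swap s t).SameCycle s t := by
  by_contra hc
  have hs : (σ * swap s t).SameCycle s (σ t) := by
    have : (σ * swap s t) s = σ t := by simp
    rw [← this]
    exact sameCycle_apply_right.2 (SameCycle.refl _ _)
  have key : (σ * swap s t).SameCycle s t ∧ σ.SameCycle t t := by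
    refine sameCycle_induction (u := σ t)
      (fun v => (σ * swap s t).SameCycle s v ∧ σ.SameCycle t v)
      ⟨hs, sameCycle_apply_right.2 (SameCycle.refl _ _)⟩ ?_
      (sameCycle_apply_left.2 (SameCycle.refl _ _))
    rintro v ⟨h1, h2⟩
    have hv1 : v ≠ s := fun h => hst (h ▸ h2.symm)
    have hv2 : v ≠ t := fun h => hc (h ▸ h1)
    have : (σ * swap s t) v = σ v := by simp [swap_apply_of_ne_of_ne hv1 hv2]
    exact ⟨this ▸ sameCycle_apply_right.2 h1, sameCycle_apply_right.2 h2⟩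
  exact hc key.1

lemma sameCycle_mul_swap_of_sameCycle (hst : ¬ σ.SameCycle s t) {v : V}
    (h : σ.SameCycle s v ∨ σ.SameCycle t v) : (σ * swap s t).SameCycle s v := by
  have hs := sameCycle_mul_swap hst
  have step : ∀ v, (σ * swap s t).SameCycle s v → (σ * swap s t).SameCycle s (σ v) := by
    intro v hv
    rcases eq_or_ne v s with rfl | h1
    · have : (σ * swap v t) t = σ v := by simp
      exact this ▸ sameCycle_apply_right.2 hs
    · rcases eq_or_ne v t with rfl | h2
      · have : (σ * swap s v) s = σ v := by simp
        exact this ▸ sameCycle_apply_right.2 (SameCycle.refl _ _)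
      · have : (σ * swap s t) v = σ v := by simp [swap_apply_of_ne_of_ne h1 h2]
        exact this ▸ sameCycle_apply_right.2 hv
  rcases h with h | h
  · exact sameCycle_induction _ (SameCycle.refl _ _) step h
  · exact sameCycle_induction _ hs step h

lemma sameCycle_mul_swap_iff (hst : ¬ σ.SameCycle s t) (v : V) :
    (σ * swap s t).SameCycle s v ↔ σ.SameCycle s v ∨ σ.SameCycle t v := by
  refine ⟨fun h => ?_, sameCycle_mul_swap_of_sameCycle hst⟩
  refine sameCycle_induction (fun v => σ.SameCycle s v ∨ σ.SameCycle t v)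
    (Or.inl (SameCycle.refl _ _)) (fun v hv => ?_) h
  simp only [Perm.mul_apply, sameCycle_apply_right]
  rcases eq_or_ne v s with rfl | h1
  · simp [SameCycle.refl]
  · rcases eq_or_ne v t with rfl | h2
    · simp [SameCycle.refl]
    · rwa [swap_apply_of_ne_of_ne h1 h2]

lemma len_mul_swap_left (hst : ¬ σ.SameCycle s t) :
    len (σ * swap s t) s = len σ s + len σ t := by
  unfold len
  rw [← Finset.card_union_of_disjoint, ← Finset.filter_or]
  · simp only [sameCycle_mul_swap_iff hst]
  · rw [Finset.disjoint_filter]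
    exact fun v _ h1 h2 => hst (h1.trans h2.symm)

lemma len_mul_swap_right (hst : ¬ σ.SameCycle s t) :
    len (σ * swap s t) t = len σ s + len σ t := by
  rw [← len_eq_of_sameCycle (sameCycle_mul_swap hst), len_mul_swap_left hst]

lemma len_mul_swap_of_not {v : V} (h1 : ¬ σ.SameCycle s v)
    (h2 : ¬ σ.SameCycle t v) : len (σ * swap s t) v = len σ v := by
  have hne : ∀ w, σ.SameCycle v w → (σ * swap s t) w = σ w := by
    intro w hw
    have hs : w ≠ s := fun h => h1 (h ▸ hw.symm)
    have ht : w ≠ t := fun h => h2 (h ▸ hw.symm)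
    simp [swap_apply_of_ne_of_ne hs ht]
  unfold len
  congr 1
  ext w
  simp only [Finset.mem_filter, Finset.mem_univ, true_and]
  constructor
  · refine sameCycle_induction (fun w => σ.SameCycle v w) (SameCycle.refl _ _) fun w hw => ?_
    rw [hne w hw]
    exact sameCycle_apply_right.2 hw
  · intro h
    refine (sameCycle_induction (fun w => (σ * swap s t).SameCycle v w ∧ σ.SameCycle v w)
      ⟨SameCycle.refl _ _, SameCycle.refl _ _⟩ (fun w hw => ?_) h).1
    exact ⟨hne w hw.2 ▸ sameCycle_apply_right.2 hw.1, sameCycle_apply_right.2 hw.2⟩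

lemma ct_mul_swap (hst : ¬ σ.SameCycle s t) {M : Multiset ℕ}
    (hM : ct σ = len σ s ::ₘ len σ t ::ₘ M) :
    ct (σ * swap s t) = (len σ s + len σ t) ::ₘ M := by
  have hpos := len_pos σ s
  refine ct_eq_of_cnt (fun h => ?_) fun n => ?_
  · rcases Multiset.mem_cons.1 h with h | h
    · omega
    · have : 0 ∈ ct σ := by rw [hM]; simp [h]
      have := one_le_of_mem_ct this
      omega
  · have h1 := cnt_eq σ n
    have hs : (∑ v, if σ.SameCycle s v then 1 else 0) = len σ s := by simp [len]
    have ht : (∑ v, if σ.SameCycle t v then 1 else 0) = len σ t := by simp [len]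
    have key : cnt (σ * swap s t) n
        + (∑ v, if σ.SameCycle s v then 1 else 0) * (if len σ s = n then 1 else 0)
        + (∑ v, if σ.SameCycle t v then 1 else 0) * (if len σ t = n then 1 else 0)
        = cnt σ n + ((∑ v, if σ.SameCycle s v then 1 else 0)
          + ∑ v, if σ.SameCycle t v then 1 else 0) * (if len σ s + len σ t = n then 1 else 0) := by
      unfold cnt
      rw [← Finset.sum_add_distrib, Finset.sum_mul, Finset.sum_mul, Finset.sum_mul,
        ← Finset.sum_add_distrib, ← Finset.sum_add_distrib, ← Finset.sum_add_distrib]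
      refine Finset.sum_congr rfl fun v _ => ?_
      by_cases h1 : σ.SameCycle s v
      · have h2 : ¬ σ.SameCycle t v := fun h2 => hst (h1.trans h2.symm)
        have e1 := len_eq_of_sameCycle ((sameCycle_mul_swap_iff hst v).2 (Or.inl h1))
        rw [len_mul_swap_left hst] at e1
        have e2 := len_eq_of_sameCycle h1
        simp only [h1, h2, ← e1, ← e2, if_true, if_false]
        ring
      · by_cases h2 : σ.SameCycle t v
        · have e1 := len_eq_of_sameCycle ((sameCycle_mul_swap_iff hst v).2 (Or.inr h2))
          rw [len_mul_swap_left hst] at e1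
          have e2 := len_eq_of_sameCycle h2
          simp only [h1, h2, ← e1, ← e2, if_true, if_false]
          ring
        · simp [h1, h2, len_mul_swap_of_not h1 h2]
    rw [hs, ht, h1, hM, Multiset.count_cons, Multiset.count_cons] at key
    rw [Multiset.count_cons]
    simp only [eq_comm (a := n)] at key ⊢
    split_ifs at key ⊢ <;> subst_vars <;> nlinarith

end Merge

end CycleType

section Conjugation

variable {V : Type} [Fintype V] [DecidableEq V]

lemma exists_commute_map_of_len_eq {σ : Perm V} {s t : V} (h : len σ s = len σ t) :
    ∃ g : Perm V, g * σ = σ * g ∧ g s = t := by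
  by_cases hs : σ s = s
  · have ht : σ t = t := by
      by_contra ht
      rw [len_of_fixed hs, len_of_not_fixed ht] at h
      have := (isCycle_cycleOf σ ht).two_le_card_support
      omega
    refine ⟨swap s t, ?_, swap_apply_left _ _⟩
    have := Equiv.swap_mul_eq_mul_swap σ s t
    rw [Perm.inv_eq_iff_eq.2 hs.symm, Perm.inv_eq_iff_eq.2 ht.symm] at this
    exact this
  · have ht : σ t ≠ t := by
      intro ht
      rw [len_of_fixed ht, len_of_not_fixed hs] at h
      have := (isCycle_cycleOf σ hs).two_le_card_support
      omega
    rw [len_of_not_fixed hs, len_of_not_fixed ht] at h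
    have hs' : σ.cycleOf s ∈ σ.cycleFactorsFinset :=
      cycleOf_mem_cycleFactorsFinset_iff.2 (mem_support.2 hs)
    have ht' : σ.cycleOf t ∈ σ.cycleFactorsFinset :=
      cycleOf_mem_cycleFactorsFinset_iff.2 (mem_support.2 ht)
    obtain ⟨k, hk⟩ := (OnCycleFactors.mem_range_toPermHom_iff
      (τ := swap (⟨_, hs'⟩ : σ.cycleFactorsFinset) ⟨_, ht'⟩)).2 (fun c => by
        rcases eq_or_ne c ⟨_, hs'⟩ with rfl | h1
        · simp [h]
        · rcases eq_or_ne c ⟨_, ht'⟩ with rfl | h2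
          · simp [h]
          · rw [swap_apply_of_ne_of_ne h1 h2])
    have hk1 := OnCycleFactors.coe_toPermHom σ k ⟨_, hs'⟩
    rw [hk, swap_apply_left] at hk1
    have hkc : (k : Perm V) * σ = σ * k := (Subgroup.mem_centralizer_singleton_iff.1 k.2).symm ▸ rfl
    have hks : σ.SameCycle t ((k : Perm V) s) := by
      have : (k : Perm V) s ∈ (σ.cycleOf t).support := by
        simp only at hk1
        rw [hk1, mem_support]
        simpa using hs
      exact (mem_support_cycleOf_iff.1 this).1
    obtain ⟨i, hi⟩ := hks.symm
    refine ⟨σ ^ i * k, ?_, by simpa using hi⟩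
    rw [mul_assoc, hkc, ← mul_assoc, ← mul_assoc]
    congr 1
    exact (Commute.refl σ).zpow_left i

lemma exists_conj_map_of_ct_eq {σ τ : Perm V} (h : ct σ = ct τ) {s t : V}
    (hst : len σ s = len τ t) : ∃ g : Perm V, g * σ * g⁻¹ = τ ∧ g s = t := by
  obtain ⟨g, rfl⟩ := exists_conj_of_ct_eq h
  rw [← len_conj g σ s] at hst
  obtain ⟨k, hk, hks⟩ := exists_commute_map_of_len_eq hst
  refine ⟨k * g, ?_, hks⟩
  have : k * (g * σ * g⁻¹) * k⁻¹ = g * σ * g⁻¹ := by rw [hk, mul_inv_cancel_right]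
  rw [← this]
  group

lemma exists_perm_ct {d : ℕ} {M : Multiset ℕ} (h1 : ∀ m ∈ M, 1 ≤ m) (hM : M.sum = d) :
    ∃ σ : Perm (Fin d), ct σ = M := by
  have hle : (M.filter (2 ≤ ·)).sum ≤ M.sum := by
    conv_rhs => rw [← Multiset.filter_add_not (2 ≤ ·) M, Multiset.sum_add]
    omega
  obtain ⟨σ, hσ⟩ := (Equiv.Perm.exists_with_cycleType_iff (α := Fin d)
    (m := M.filter (2 ≤ ·))).2 ⟨by simp; omega, fun a ha => (Multiset.mem_filter.1 ha).2⟩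
  refine ⟨σ, ?_⟩
  have hr : M.filter (fun m => ¬ 2 ≤ m) =
      Multiset.replicate (M.filter fun m => ¬ 2 ≤ m).card 1 := by
    rw [Multiset.eq_replicate_card]
    intro m hm
    have := h1 m (Multiset.mem_filter.1 hm).1
    have := (Multiset.mem_filter.1 hm).2
    omega
  have hs := congrArg Multiset.sum (Multiset.filter_add_not (2 ≤ ·) M)
  rw [Multiset.sum_add, hM] at hs
  have hr' := congrArg Multiset.sum hr
  rw [Multiset.sum_replicate, smul_eq_mul, mul_one] at hr'
  rw [ct, hσ, Fintype.card_fin]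
  conv_rhs => rw [← Multiset.filter_add_not (2 ≤ ·) M, hr]
  congr 2
  omega

/-- The quantity `∑ (m - 1)` over the parts of `M`. -/
def nu (M : Multiset ℕ) : ℕ := (M.map (· - 1)).sum

@[simp] lemma nu_zero : nu 0 = 0 := rfl

@[simp] lemma nu_cons (m : ℕ) (M : Multiset ℕ) : nu (m ::ₘ M) = (m - 1) + nu M := by simp [nu]

@[simp] lemma nu_add (M N : Multiset ℕ) : nu (M + N) = nu M + nu N := by simp [nu]

@[simp] lemma nu_replicate_one (n : ℕ) : nu (Multiset.replicate n 1) = 0 := by simp [nu]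

lemma nu_add_card {M : Multiset ℕ} (h : ∀ m ∈ M, 1 ≤ m) : nu M + M.card = M.sum := by
  induction M using Multiset.induction with
  | empty => simp
  | cons m M ih =>
    have := ih fun k hk => h k (Multiset.mem_cons_of_mem hk)
    have := h m (Multiset.mem_cons_self _ _)
    simp only [nu_cons, Multiset.card_cons, Multiset.sum_cons]
    omega

lemma nu_ct_add_card (σ : Perm V) : nu (ct σ) + (ct σ).card = Fintype.card V := by
  rw [nu_add_card fun _ => one_le_of_mem_ct, ct_sum]

end Conjugation

section Lists

variable {V W : Type}

/-- The set `{u | f u}` is a union of orbits of `a`. -/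
def Inv (f : V → Prop) (a : Perm V) : Prop := ∀ u, f (a u) ↔ f u

/-- The permutations in the list generate a transitive group. -/
def Tr (L : List (Perm V)) : Prop := ∀ f : V → Prop, (∀ a ∈ L, Inv f a) → ∀ u v, f u → f v

lemma Inv.one (f : V → Prop) : Inv f 1 := fun _ => Iff.rfl

lemma Inv.mul {f : V → Prop} {a b : Perm V} (ha : Inv f a) (hb : Inv f b) : Inv f (a * b) :=
  fun u => (ha (b u)).trans (hb u)

lemma Inv.inv {f : V → Prop} {a : Perm V} (ha : Inv f a) : Inv f a⁻¹ :=
  fun u => by rw [← ha (a⁻¹ u)]; simp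

lemma Inv.of_conj {f : V → Prop} {a b : Perm V} (ha : Inv f a) (hb : Inv f (a * b * a⁻¹)) :
    Inv f b := by
  have := (ha.inv.mul hb).mul ha
  rwa [show a⁻¹ * (a * b * a⁻¹) * a = b by group] at this

lemma Inv.prod {f : V → Prop} {L : List (Perm V)} (h : ∀ a ∈ L, Inv f a) : Inv f L.prod := by
  induction L with
  | nil => exact Inv.one f
  | cons a L ih =>
    rw [List.prod_cons]
    exact (h a (by simp)).mul (ih fun b hb => h b (by simp [hb]))

lemma Inv.of_sameCycle [Fintype V] [DecidableEq V] {f : V → Prop} {a : Perm V} (ha : Inv f a)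
    {u v : V} (h : a.SameCycle u v) : f u ↔ f v :=
  sameCycle_induction (fun v => f u ↔ f v) Iff.rfl (fun v hv => hv.trans (ha v).symm) h

lemma Tr.mono {L L' : List (Perm V)} (h : Tr L)
    (hL : ∀ f : V → Prop, (∀ a ∈ L', Inv f a) → ∀ a ∈ L, Inv f a) : Tr L' :=
  fun f hf => h f (hL f hf)

lemma exists_perm_list [Fintype V] [DecidableEq V] {O O' : List (Multiset ℕ)} (h : O.Perm O') :
    ∀ L : List (Perm V), L.map ct = O → ∃ L' : List (Perm V), L'.map ct = O' ∧ L'.prod = L.prod ∧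
      ∀ f : V → Prop, (∀ a ∈ L', Inv f a) → ∀ a ∈ L, Inv f a := by
  induction h with
  | nil => exact fun L hL => ⟨L, hL, rfl, fun f hf => hf⟩
  | cons M _ ih =>
    intro L hL
    obtain ⟨a, L1, rfl, rfl, hL1⟩ := List.map_eq_cons_iff.1 hL
    obtain ⟨L', h1, h2, h3⟩ := ih L1 hL1
    refine ⟨a :: L', by simp [h1], by simp [h2], fun f hf => ?_⟩
    simp only [List.mem_cons, forall_eq_or_imp] at hf ⊢
    exact ⟨hf.1, h3 f hf.2⟩
  | swap M N l =>
    intro L hL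
    obtain ⟨a, L1, rfl, rfl, hL1⟩ := List.map_eq_cons_iff.1 hL
    obtain ⟨b, L2, rfl, rfl, rfl⟩ := List.map_eq_cons_iff.1 hL1
    refine ⟨(a * b * a⁻¹) :: a :: L2, by simp [ct_conj], by simp [mul_assoc], fun f hf => ?_⟩
    simp only [List.mem_cons, forall_eq_or_imp] at hf ⊢
    exact ⟨hf.2.1, hf.2.1.of_conj hf.1, hf.2.2⟩
  | trans _ _ ih1 ih2 =>
    intro L hL
    obtain ⟨L', h1, h2, h3⟩ := ih1 L hL
    obtain ⟨L'', k1, k2, k3⟩ := ih2 L' h1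
    exact ⟨L'', k1, k2.trans h2, fun f hf => h3 f (k3 f hf)⟩

end Lists

section Meet

variable {V W : Type} [Fintype V] [DecidableEq V] [Fintype W] [DecidableEq W]

/-- There are permutations of cycle types `O`, `P`, `Q` with product `1` generating a transitive
group, such that some point lies on a cycle of length `y` of the permutation of type `P` and on a
cycle of length `x` of the permutation of type `Q`. -/
def Meet (V : Type) [Fintype V] [DecidableEq V] (O : List (Multiset ℕ)) (P Q : Multiset ℕ)
    (y x : ℕ) : Prop :=
  ∃ (L : List (Perm V)) (a b : Perm V) (s : V), L.map ct = O ∧ ct a = P ∧ ct b = Q ∧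
    L.prod * a * b = 1 ∧ Tr (a :: b :: L) ∧ len a s = y ∧ len b s = x

/-- The analogue of `Meet` with three distinguished permutations. -/
def Meet3 (V : Type) [Fintype V] [DecidableEq V] (O : List (Multiset ℕ)) (C P Q : Multiset ℕ)
    (z y x : ℕ) : Prop :=
  ∃ (L : List (Perm V)) (c a b : Perm V) (s : V), L.map ct = O ∧ ct c = C ∧ ct a = P ∧ ct b = Q ∧
    L.prod * c * a * b = 1 ∧ Tr (c :: a :: b :: L) ∧ len c s = z ∧ len a s = y ∧ len b s = x

variable {O O' : List (Multiset ℕ)} {P Q C A B : Multiset ℕ} {x y z u v : ℕ}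

lemma Meet.perm (h : Meet V O P Q y x) (hO : O.Perm O') : Meet V O' P Q y x := by
  obtain ⟨L, a, b, s, h1, h2, h3, h4, h5, h6, h7⟩ := h
  obtain ⟨L', k1, k2, k3⟩ := exists_perm_list hO L h1
  refine ⟨L', a, b, s, k1, h2, h3, by rw [k2, h4], h5.mono fun f hf => ?_, h6, h7⟩
  simp only [List.mem_cons, forall_eq_or_imp] at hf ⊢
  exact ⟨hf.1, hf.2.1, k3 f hf.2.2⟩

lemma Meet.map (e : V ≃ W) (h : Meet V O P Q y x) : Meet W O P Q y x := by
  obtain ⟨L, a, b, s, h1, h2, h3, h4, h5, h6, h7⟩ := h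
  have hc : ∀ σ : Perm V, ct (e.permCongrHom σ) = ct σ := fun σ => ct_map e fun u => by
    simp [Equiv.permCongrHom]
  have hl : ∀ (σ : Perm V) (u : V), len (e.permCongrHom σ) (e u) = len σ u := fun σ u =>
    len_map e.injective (fun u => by simp [Equiv.permCongrHom]) u
  refine ⟨L.map e.permCongrHom, e.permCongrHom a, e.permCongrHom b, e s, ?_, ?_, ?_, ?_, ?_, ?_, ?_⟩
  · rw [← h1, List.map_map]
    exact List.map_congr_left fun σ _ => hc σ
  · rw [hc, h2]
  · rw [hc, h3]
  · rw [← map_list_prod, ← map_mul, ← map_mul, h4, map_one]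
  · intro f hf w w' hw
    have := h5 (fun u => f (e u)) (fun σ hσ u => by
      have h := hf (e.permCongrHom σ) (by
        rw [← List.map_cons, ← List.map_cons]; exact List.mem_map_of_mem hσ) (e u)
      simpa [Equiv.permCongrHom] using h) (e.symm w) (e.symm w') (by simpa using hw)
    simpa using this
  · rw [hl, h6]
  · rw [hl, h7]

lemma Meet3.toMeet (h : Meet3 V O C P Q z y x) : Meet V (C :: O) P Q y x := by
  obtain ⟨L, c, a, b, s, rfl, rfl, rfl, rfl, h5, h6, rfl, rfl, rfl⟩ := h
  have : Meet V ((L ++ [c]).map ct) (ct a) (ct b) (len a s) (len b s) := by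
    refine ⟨L ++ [c], a, b, s, rfl, rfl, rfl, by simpa using h5, h6.mono fun f hf => ?_, rfl, rfl⟩
    simp only [List.mem_cons, forall_eq_or_imp, List.mem_append] at hf ⊢
    exact ⟨hf.2.2 c (by simp), hf.1, hf.2.1, fun a ha => hf.2.2 a (by simp [ha])⟩
  exact this.perm (by rw [List.map_append]; exact List.perm_append_singleton _ _)

lemma Meet3.toMeet' (h : Meet3 V O C P Q z y x) : Meet V (P :: O) C Q z x := by
  obtain ⟨L, c, a, b, s, rfl, rfl, rfl, rfl, h5, h6, rfl, rfl, rfl⟩ := h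
  have : Meet V ((L ++ [c * a * c⁻¹]).map ct) (ct c) (ct b) (len c s) (len b s) := by
    refine ⟨L ++ [c * a * c⁻¹], c, b, s, rfl, rfl, rfl, by simpa [mul_assoc] using h5,
      h6.mono fun f hf => ?_, rfl, rfl⟩
    simp only [List.mem_cons, forall_eq_or_imp, List.mem_append] at hf ⊢
    exact ⟨hf.1, hf.1.of_conj (hf.2.2 (c * a * c⁻¹) (by simp)), hf.2.1,
      fun a ha => hf.2.2 a (by simp [ha])⟩
  refine this.perm ?_
  rw [List.map_append, List.map_singleton, ct_conj]
  exact List.perm_append_singleton _ _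

/-- There are permutations of types `A`, `B` whose product has type `K`, with a common point on
cycles of lengths `u` and `v`. -/
def Pair (V : Type) [Fintype V] [DecidableEq V] (A B K : Multiset ℕ) (u v : ℕ) : Prop :=
  ∃ (a b : Perm V) (s : V), ct a = A ∧ ct b = B ∧ ct (a * b) = K ∧ len a s = u ∧ len b s = v

lemma Meet.split_left {K : Multiset ℕ} (h : Meet V O K Q y x) (hp : Pair V A B K u v) :
    Meet V (Q :: O) A B u v := by
  obtain ⟨L, a, b, s, rfl, h2, rfl, h4, h5, -, -⟩ := h
  obtain ⟨α, β, t, rfl, rfl, rfl, rfl, rfl⟩ := hp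
  obtain ⟨g, rfl⟩ := exists_conj_of_ct_eq h2.symm
  refine ⟨b :: L, g * α * g⁻¹, g * β * g⁻¹, g t, by simp, ct_conj _ _, ct_conj _ _, ?_,
    h5.mono fun f hf => ?_, len_conj _ _ _, len_conj _ _ _⟩
  · rw [← mul_eq_one_iff_eq_inv.2 (eq_inv_of_mul_eq_one_right h4)]
    simp [mul_assoc]
  · simp only [List.mem_cons, forall_eq_or_imp] at hf ⊢
    refine ⟨?_, hf.2.2.1, hf.2.2.2⟩
    have := hf.1.mul hf.2.1
    rwa [show g * α * g⁻¹ * (g * β * g⁻¹) = g * (α * β) * g⁻¹ by group] at this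

lemma Meet.split_right {K : Multiset ℕ} (h : Meet V O P K y x) (hp : Pair V A B K u v) :
    Meet V (P :: O) A B u v := by
  obtain ⟨L, a, b, s, rfl, rfl, h3, h4, h5, -, -⟩ := h
  obtain ⟨α, β, t, rfl, rfl, rfl, rfl, rfl⟩ := hp
  obtain ⟨g, rfl⟩ := exists_conj_of_ct_eq h3.symm
  have : Meet V ((L ++ [a]).map ct) (ct α) (ct β) (len α t) (len β t) := by
    refine ⟨L ++ [a], g * α * g⁻¹, g * β * g⁻¹, g t, by simp, ct_conj _ _, ct_conj _ _, ?_,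
      h5.mono fun f hf => ?_, len_conj _ _ _, len_conj _ _ _⟩
    · rw [← h4]
      simp [mul_assoc]
    · simp only [List.mem_cons, forall_eq_or_imp, List.mem_append] at hf ⊢
      refine ⟨hf.2.2 a (by simp), ?_, fun a ha => hf.2.2 a (by simp [ha])⟩
      have := hf.1.mul hf.2.1
      rwa [show g * α * g⁻¹ * (g * β * g⁻¹) = g * (α * β) * g⁻¹ by group] at this
  exact this.perm (by rw [List.map_append]; exact List.perm_append_singleton _ _)

/-- Splitting the second distinguished permutation while keeping track of the meeting cycles. -/
lemma Meet.split_meet (h : ∀ w ∈ B, Meet V O P B y w) {J : Multiset ℕ}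
    (hp : Pair V J Q B z x) : Meet V (J :: O) P Q y x := by
  obtain ⟨α, β, t, rfl, rfl, rfl, rfl, rfl⟩ := hp
  obtain ⟨L, a, b, s, rfl, rfl, h3, h4, h5, rfl, h7⟩ := h (len (α * β) t) (len_mem_ct _ _)
  obtain ⟨g, rfl, rfl⟩ := exists_conj_map_of_ct_eq h3.symm h7.symm
  have : Meet V ((L ++ [a * (g * α * g⁻¹) * a⁻¹]).map ct) (ct a) (ct β) (len a (g t))
      (len β t) := by
    refine ⟨L ++ [a * (g * α * g⁻¹) * a⁻¹], a, g * β * g⁻¹, g t, rfl, rfl, ct_conj _ _, ?_,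
      h5.mono fun f hf => ?_, rfl, len_conj _ _ _⟩
    · rw [← h4]
      simp [mul_assoc]
    · simp only [List.mem_cons, forall_eq_or_imp, List.mem_append] at hf ⊢
      refine ⟨hf.1, ?_, fun a ha => hf.2.2 a (by simp [ha])⟩
      have := (hf.1.of_conj (hf.2.2 (a * (g * α * g⁻¹) * a⁻¹) (by simp))).mul hf.2.1
      rwa [show g * α * g⁻¹ * (g * β * g⁻¹) = g * (α * β) * g⁻¹ by group] at this
  refine this.perm ?_
  rw [List.map_append, List.map_singleton, ct_conj, ct_conj]
  exact List.perm_append_singleton _ _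

end Meet

section Glue

variable {V W : Type}

/-- The permutation of `V ⊕ W` acting by `σ` and `τ`. -/
def φ (σ : Perm V) (τ : Perm W) : Perm (V ⊕ W) := Equiv.sumCongr σ τ

lemma φ_mul (σ σ' : Perm V) (τ τ' : Perm W) : φ σ τ * φ σ' τ' = φ (σ * σ') (τ * τ') :=
  Equiv.Perm.sumCongr_mul _ _ _ _

lemma φ_one : φ (1 : Perm V) (1 : Perm W) = 1 := Equiv.Perm.sumCongr_one

lemma prod_map_φ (L : List (Perm V)) : (L.map (φ · (1 : Perm W))).prod = φ L.prod 1 := by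
  induction L with
  | nil => exact φ_one.symm
  | cons a L ih => rw [List.map_cons, List.prod_cons, ih, φ_mul, List.prod_cons, one_mul]

lemma Inv.inl {f : V ⊕ W → Prop} {σ : Perm V} {τ : Perm W} (h : Inv f (φ σ τ)) :
    Inv (fun v => f (Sum.inl v)) σ := fun u => h (Sum.inl u)

lemma Inv.inr {f : V ⊕ W → Prop} {σ : Perm V} {τ : Perm W} (h : Inv f (φ σ τ)) :
    Inv (fun v => f (Sum.inr v)) τ := fun u => h (Sum.inr u)

variable {f : V ⊕ W → Prop} {s : V} {t : W}

lemma forall_sum (hV : ∀ u v, f (Sum.inl u) → f (Sum.inl v))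
    (hW : ∀ u v, f (Sum.inr u) → f (Sum.inr v)) (hst : f (Sum.inl s) ↔ f (Sum.inr t)) :
    ∀ u v, f u → f v := by
  rintro (u | u) (v | v) h
  · exact hV u v h
  · exact hW t v (hst.1 (hV u s h))
  · exact hV s v (hst.2 (hW u t h))
  · exact hW u v h

variable [DecidableEq V] [DecidableEq W]

/-- The transposition along which two permutation systems are glued. -/
def sw (s : V) (t : W) : Perm (V ⊕ W) := swap (Sum.inl s) (Sum.inr t)

lemma sw_mul_self (s : V) (t : W) : sw s t * sw s t = 1 := swap_mul_self _ _

lemma sw_mul_eq (s : V) (t : W) (τ : Perm (V ⊕ W)) :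
    sw s t * τ = sw s t * (τ * sw s t) * (sw s t)⁻¹ := by
  simp [mul_assoc]

lemma inv_sw (h : f (Sum.inl s) ↔ f (Sum.inr t)) : Inv f (sw s t) := by
  intro u
  unfold sw
  rcases eq_or_ne u (Sum.inl s) with rfl | h1
  · rw [swap_apply_left, h]
  · rcases eq_or_ne u (Sum.inr t) with rfl | h2
    · rw [swap_apply_right, h]
    · rw [swap_apply_of_ne_of_ne h1 h2]

lemma Inv.glue_right {σ : Perm V} {τ : Perm W} (hst : f (Sum.inl s) ↔ f (Sum.inr t))
    (h : Inv f (sw s t * φ σ τ)) : Inv f (φ σ τ) := by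
  have := (inv_sw hst).mul h
  rwa [← mul_assoc, sw_mul_self, one_mul] at this

variable [Fintype V] [Fintype W] {σ : Perm V} {τ : Perm W}

lemma Inv.glue_iff (h : Inv f (φ σ τ * sw s t)) : f (Sum.inl s) ↔ f (Sum.inr t) :=
  h.of_sameCycle (sameCycle_mul_swap (not_sameCycle_sumCongr σ τ s t))

lemma Inv.glue_left (h : Inv f (φ σ τ * sw s t)) : Inv f (φ σ τ) := by
  have := h.mul (inv_sw h.glue_iff)
  rwa [mul_assoc, sw_mul_self, mul_one] at this

lemma ct_φ (σ : Perm V) (τ : Perm W) : ct (φ σ τ) = ct σ + ct τ := ct_sumCongr σ τ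

lemma ct_glue_left {A B : Multiset ℕ} (hA : ct σ = len σ s ::ₘ A) (hB : ct τ = len τ t ::ₘ B) :
    ct (φ σ τ * sw s t) = (len σ s + len τ t) ::ₘ (A + B) := by
  have := ct_mul_swap (not_sameCycle_sumCongr σ τ s t) (M := A + B) (by
    rw [len_sumCongr_inl, len_sumCongr_inr, ct_sumCongr, hA, hB, Multiset.cons_add,
      Multiset.add_cons])
  rwa [len_sumCongr_inl, len_sumCongr_inr] at this

lemma ct_glue_right {A B : Multiset ℕ} (hA : ct σ = len σ s ::ₘ A) (hB : ct τ = len τ t ::ₘ B) :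
    ct (sw s t * φ σ τ) = (len σ s + len τ t) ::ₘ (A + B) := by
  rw [sw_mul_eq, ct_conj, ct_glue_left hA hB]

lemma len_glue_left : len (φ σ τ * sw s t) (Sum.inr t) = len σ s + len τ t := by
  have := len_mul_swap_right (not_sameCycle_sumCongr σ τ s t)
  rwa [len_sumCongr_inl, len_sumCongr_inr] at this

lemma len_glue_right : len (sw s t * φ σ τ) (Sum.inr t) = len σ s + len τ t := by
  have := len_mul_swap_left (not_sameCycle_sumCongr σ τ s t)
  rw [len_sumCongr_inl, len_sumCongr_inr] at this
  have h := len_conj (sw s t) (φ σ τ * sw s t) (Sum.inl s)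
  rw [← sw_mul_eq, show sw s t (Sum.inl s) = Sum.inr t from swap_apply_left _ _] at h
  rw [h]
  exact this

lemma len_φ_inr (w : W) : len (φ σ τ) (Sum.inr w) = len τ w := len_sumCongr_inr σ τ w

end Glue

section Moves

/-- The multiset of `n` ones. -/
abbrev ones (n : ℕ) : Multiset ℕ := Multiset.replicate n 1

lemma Inv.of_len_eq_card {V : Type} [Fintype V] [DecidableEq V] {f : V → Prop} {a : Perm V}
    (hf : Inv f a) {u v : V} (h : len a u = Fintype.card V) (hu : f u) : f v := by
  unfold len at h
  have hv := Finset.mem_univ v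
  rw [← (Finset.card_eq_iff_eq_univ _).1 h] at hv
  exact (hf.of_sameCycle (Finset.mem_filter.1 hv).2).1 hu

lemma exists_cycle {p : ℕ} (hp : 1 ≤ p) : ∃ ρ : Perm (Fin p), ct ρ = {p} ∧ (∀ t, len ρ t = p) ∧
    ∀ f : Fin p → Prop, Inv f ρ → ∀ u v, f u → f v := by
  obtain ⟨ρ, hρ⟩ := exists_perm_ct (M := {p}) (d := p) (by simpa) (by simp)
  have hl : ∀ t, len ρ t = p := fun t => by simpa [hρ] using len_mem_ct ρ t
  refine ⟨ρ, hρ, hl, fun f hf u v hu => ?_⟩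
  exact hf.of_len_eq_card ((hl u).trans (Fintype.card_fin p).symm) hu

variable {V : Type} [Fintype V] [DecidableEq V] {O : List (Multiset ℕ)} {C P Q A B : Multiset ℕ}
  {p x y z w : ℕ}

lemma ones_eq (hp : 1 ≤ p) : ones p = 1 ::ₘ ones (p - 1) := by
  obtain ⟨q, rfl⟩ := Nat.exists_eq_add_of_le' hp
  rw [ones, Multiset.replicate_succ]
  rfl

lemma map_ct_φ (L : List (Perm V)) :
    (L.map (φ · (1 : Perm (Fin p)))).map ct = (L.map ct).map (· + ones p) := by
  rw [List.map_map, List.map_map]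
  refine List.map_congr_left fun σ _ => ?_
  simp only [Function.comp]
  rw [ct_φ, ct_one, Fintype.card_fin]

lemma ct_one_cons (hp : 1 ≤ p) (t : Fin p) :
    ct (1 : Perm (Fin p)) = len (1 : Perm (Fin p)) t ::ₘ ones (p - 1) := by
  rw [ct_one, len_of_fixed (by simp), Fintype.card_fin]
  exact ones_eq hp

lemma Meet.glue_pq (hp : 1 ≤ p) (h : Meet V (C :: O) (y ::ₘ P) (x ::ₘ Q) y x) :
    Meet3 (V ⊕ Fin p) (O.map (· + ones p)) (p ::ₘ C) ((y + 1) ::ₘ (P + ones (p - 1)))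
      ((x + p) ::ₘ Q) p (y + 1) (x + p) := by
  obtain ⟨L', a, b, s, h1, h2, h3, h4, h5, h6, h7⟩ :=
    h.perm (List.perm_append_singleton _ _).symm
  obtain ⟨L, L1, rfl, rfl, hc⟩ := List.map_eq_append_iff.1 h1
  obtain ⟨c, rfl, rfl⟩ := List.map_eq_singleton_iff.1 hc
  obtain ⟨ρ, r1, r2, r3⟩ := exists_cycle hp
  let t : Fin p := ⟨0, hp⟩
  have ht := ct_one_cons hp t
  have hr : ct ρ⁻¹ = len ρ⁻¹ t ::ₘ 0 := by rw [ct_inv, len_inv, r1, r2]; rfl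
  have h1t : len (1 : Perm (Fin p)) t = 1 := len_of_fixed (by simp)
  refine ⟨L.map (φ · 1), φ c ρ, φ a 1 * sw s t, sw s t * φ b ρ⁻¹, Sum.inr t, map_ct_φ L,
    ?_, ?_, ?_, ?_, fun f hf => ?_, ?_, ?_, ?_⟩
  · rw [ct_φ, r1, add_comm]; rfl
  · rw [ct_glue_left (by rw [h2, h6]) ht, h6, h1t]
  · rw [ct_glue_right (by rw [h3, h7]) hr, h7, len_inv, r2, add_zero]
  · have : (φ a 1 * sw s t) * (sw s t * φ b ρ⁻¹) = φ (a * b) (ρ⁻¹) := by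
      rw [mul_assoc, ← mul_assoc (sw s t), sw_mul_self, one_mul, φ_mul, one_mul]
    rw [mul_assoc, this, prod_map_φ, φ_mul, φ_mul, one_mul, mul_inv_cancel, ← mul_assoc]
    simpa [φ_one] using congrArg (fun g => φ g (1 : Perm (Fin p))) h4
  · simp only [List.mem_cons, forall_eq_or_imp, List.mem_map, forall_exists_index, and_imp,
      forall_apply_eq_imp_iff₂] at hf
    have hst := hf.2.1.glue_iff
    refine forall_sum (fun u v => h5 (fun u => f (Sum.inl u)) ?_ u v) (r3 _ hf.1.inr) hst
    simp only [List.mem_cons, forall_eq_or_imp, List.mem_append]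
    refine ⟨hf.2.1.glue_left.inl, (Inv.glue_right hst hf.2.2.1).inl, ?_⟩
    rintro σ (hσ | hσ | hσ)
    · exact (hf.2.2.2 σ hσ).inl
    · subst hσ; exact hf.1.inl
    · simp at hσ
  · rw [len_φ_inr, r2]
  · rw [len_glue_left, h6, h1t]
  · rw [len_glue_right, h7, len_inv, r2]

lemma Meet.glue_cp (hp : 1 ≤ p) (h : Meet V (Q :: O) (z ::ₘ C) (y ::ₘ P) z y) :
    Meet3 (V ⊕ Fin p) (O.map (· + ones p)) ((z + p) ::ₘ C) ((y + 1) ::ₘ (P + ones (p - 1)))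
      (p ::ₘ Q) (z + p) (y + 1) p := by
  obtain ⟨L', c, a, s, h1, h2, h3, h4, h5, h6, h7⟩ := h
  obtain ⟨b, L, rfl, rfl, rfl⟩ := List.map_eq_cons_iff.1 h1
  obtain ⟨ρ, r1, r2, r3⟩ := exists_cycle hp
  let t : Fin p := ⟨0, hp⟩
  have ht := ct_one_cons hp t
  have hr : ct ρ = len ρ t ::ₘ 0 := by rw [r1, r2]; rfl
  have h1t : len (1 : Perm (Fin p)) t = 1 := len_of_fixed (by simp)
  refine ⟨L.map (φ · 1), φ c ρ * sw s t, sw s t * φ a 1, φ b ρ⁻¹, Sum.inr t, map_ct_φ L,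
    ?_, ?_, ?_, ?_, fun f hf => ?_, ?_, ?_, ?_⟩
  · rw [ct_glue_left (by rw [h2, h6]) hr, h6, r2, add_zero]
  · rw [ct_glue_right (by rw [h3, h7]) ht, h7, h1t]
  · rw [ct_φ, ct_inv, r1, add_comm]; rfl
  · have : (φ c ρ * sw s t) * (sw s t * φ a 1) = φ (c * a) ρ := by
      rw [mul_assoc, ← mul_assoc (sw s t), sw_mul_self, one_mul, φ_mul, mul_one]
    rw [mul_assoc _ _ (sw s t * φ a 1), this, prod_map_φ, φ_mul, φ_mul, one_mul, mul_inv_cancel,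
      ← φ_one]
    congr 1
    rw [mul_eq_one_iff_eq_inv, ← mul_assoc]
    rw [List.prod_cons, mul_assoc, mul_assoc] at h4
    rw [← eq_inv_of_mul_eq_one_right h4, mul_assoc]
  · simp only [List.mem_cons, forall_eq_or_imp, List.mem_map, forall_exists_index, and_imp,
      forall_apply_eq_imp_iff₂] at hf
    have hst := hf.1.glue_iff
    refine forall_sum (fun u v => h5 (fun u => f (Sum.inl u)) ?_ u v) (r3 _ hf.1.glue_left.inr) hst
    simp only [List.mem_cons, forall_eq_or_imp]
    exact ⟨hf.1.glue_left.inl, (Inv.glue_right hst hf.2.1).inl, hf.2.2.1.inl,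
      fun σ hσ => (hf.2.2.2 σ hσ).inl⟩
  · rw [len_glue_left, h6, r2]
  · rw [len_glue_right, h7, h1t]
  · rw [len_φ_inr, len_inv, r2]

/-- Gluing along the `P`-permutation and an auxiliary permutation of type `w ::ₘ A`. -/
lemma Meet.glue_pl (hp : 1 ≤ p)
    (h : Meet V (Q :: C :: O) (y ::ₘ P) (w ::ₘ A) y w) :
    Meet3 (V ⊕ Fin p) (((w + 1) ::ₘ (A + ones (p - 1))) :: O.map (· + ones p)) (p ::ₘ C)
      ((y + 1) ::ₘ (P + ones (p - 1))) (p ::ₘ Q) p (y + 1) p := by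
  obtain ⟨L', a, l, s, h1, h2, h3, h4, h5, h6, h7⟩ := h.perm
    (O' := Q :: (O ++ [C])) ((List.perm_append_singleton _ _).symm.cons _)
  obtain ⟨b, L2, rfl, rfl, h2'⟩ := List.map_eq_cons_iff.1 h1
  obtain ⟨L, L1, rfl, rfl, hc⟩ := List.map_eq_append_iff.1 h2'
  obtain ⟨c, rfl, rfl⟩ := List.map_eq_singleton_iff.1 hc
  obtain ⟨ρ, r1, r2, r3⟩ := exists_cycle hp
  let t : Fin p := ⟨0, hp⟩
  have ht := ct_one_cons hp t
  have h1t : len (1 : Perm (Fin p)) t = 1 := len_of_fixed (by simp)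
  have hl : ct (sw s t * φ l (1 : Perm (Fin p))) = (w + 1) ::ₘ (A + ones (p - 1)) := by
    rw [ct_glue_right (by rw [h3, h7]) ht, h7, h1t]
  obtain ⟨c', hc'⟩ : ∃ c', c' = φ c ρ := ⟨_, rfl⟩
  obtain ⟨a', ha'⟩ : ∃ a', a' = φ a (1 : Perm (Fin p)) * sw s t := ⟨_, rfl⟩
  obtain ⟨l', hl'⟩ : ∃ l', l' = sw s t * φ l (1 : Perm (Fin p)) := ⟨_, rfl⟩
  obtain ⟨M, hM⟩ : ∃ M : List (Perm (V ⊕ Fin p)), M = L.map (φ · 1) := ⟨_, rfl⟩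
  refine ⟨((M.prod * c' * a') * l' * (M.prod * c' * a')⁻¹) :: M, c', a', φ b ρ⁻¹,
    Sum.inr t, ?_, ?_, ?_, ?_, ?_, fun f hf => ?_, ?_, ?_, ?_⟩
  · rw [List.map_cons, ct_conj, hl', hl, hM, map_ct_φ]
  · rw [hc', ct_φ, r1, add_comm]; rfl
  · rw [ha', ct_glue_left (by rw [h2, h6]) ht, h6, h1t]
  · rw [ct_φ, ct_inv, r1, add_comm]; rfl
  · have : a' * l' = φ (a * l) 1 := by
      rw [ha', hl', mul_assoc, ← mul_assoc (sw s t), sw_mul_self, one_mul, φ_mul, mul_one]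
    rw [List.prod_cons, show (M.prod * c' * a') * l' * (M.prod * c' * a')⁻¹ * M.prod * c' * a' *
      φ b ρ⁻¹ = M.prod * c' * (a' * l') * φ b ρ⁻¹ by group, this, hM, prod_map_φ, hc', φ_mul,
      φ_mul, φ_mul, one_mul, mul_one, mul_inv_cancel, ← φ_one]
    congr 1
    simp only [List.prod_cons, List.prod_append, List.prod_nil, mul_one, mul_assoc] at h4 ⊢
    rw [← mul_eq_one_iff_eq_inv.2 (eq_inv_of_mul_eq_one_right h4)]
    simp [mul_assoc]
  · simp only [List.mem_cons, forall_eq_or_imp] at hf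
    obtain ⟨hc, ha, hb, hl, hM'⟩ := hf
    have hl2 := Inv.of_conj (((Inv.prod hM').mul hc).mul ha) hl
    subst hc' ha' hl' hM
    simp only [List.mem_map, forall_exists_index, and_imp, forall_apply_eq_imp_iff₂] at hM'
    have hst := ha.glue_iff
    refine forall_sum (fun u v => h5 (fun u => f (Sum.inl u)) ?_ u v) (r3 _ hc.inr) hst
    simp only [List.mem_cons, forall_eq_or_imp, List.mem_append]
    refine ⟨ha.glue_left.inl, (Inv.glue_right hst hl2).inl, hb.inl, ?_⟩
    rintro σ (hσ | hσ | hσ)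
    · exact (hM' σ hσ).inl
    · subst hσ; exact hc.inl
    · simp at hσ
  · rw [hc', len_φ_inr, r2]
  · rw [ha', len_glue_left, h6, h1t]
  · rw [len_φ_inr, len_inv, r2]

end Moves

section PairLemma

/-- `M` is a partition of `d`. -/
def Part (d : ℕ) (M : Multiset ℕ) : Prop := (∀ m ∈ M, 1 ≤ m) ∧ M.sum = d

lemma Part.nu_add_card {d : ℕ} {M : Multiset ℕ} (h : Part d M) : nu M + M.card = d := by
  rw [Hurwitz.nu_add_card h.1, h.2]

lemma part_cons {d m : ℕ} {M : Multiset ℕ} (hm : 1 ≤ m) (hd : m + M.sum = d)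
    (h : ∀ k ∈ M, 1 ≤ k) : Part d (m ::ₘ M) :=
  ⟨by simpa [hm] using h, by simpa using hd⟩

lemma part_cons_iff {d m : ℕ} {M : Multiset ℕ} :
    Part d (m ::ₘ M) ↔ 1 ≤ m ∧ m + M.sum = d ∧ ∀ k ∈ M, 1 ≤ k := by
  simp [Part]
  tauto

lemma part_ct {V : Type} [Fintype V] [DecidableEq V] (σ : Perm V) : Part (Fintype.card V) (ct σ) :=
  ⟨fun _ => one_le_of_mem_ct, ct_sum σ⟩

lemma Part.exists_mem {d : ℕ} {M : Multiset ℕ} (h : Part d M) (hd : 1 ≤ d) : ∃ m, m ∈ M := by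
  refine Multiset.exists_mem_of_ne_zero ?_
  rintro rfl
  have := h.2
  simp at this
  omega

lemma exists_two_le_of_nu_pos {M : Multiset ℕ} (h : 1 ≤ nu M) : ∃ m ∈ M, 2 ≤ m := by
  by_contra hc
  push Not at hc
  have : nu M = 0 := by
    rw [nu, Multiset.sum_eq_zero]
    intro x hx
    obtain ⟨m, hm, rfl⟩ := Multiset.mem_map.1 hx
    have := hc m hm
    omega
  omega

lemma le_nu_of_mem {M : Multiset ℕ} {m : ℕ} (h : m ∈ M) : m ≤ nu M + 1 := by
  obtain ⟨N, rfl⟩ := Multiset.exists_cons_of_mem h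
  simp only [nu_cons]
  omega

lemma Part.eq_ones {d : ℕ} {M : Multiset ℕ} (h : Part d M) (h0 : nu M = 0) : M = ones d := by
  have h1 := h.nu_add_card
  rw [Multiset.eq_replicate]
  refine ⟨by omega, fun m hm => ?_⟩
  have := h.1 m hm
  have := le_nu_of_mem hm
  omega

variable {V W : Type} [Fintype V] [DecidableEq V] [Fintype W] [DecidableEq W]
  {A B K : Multiset ℕ} {u v : ℕ}

lemma Pair.map (e : V ≃ W) (h : Pair V A B K u v) : Pair W A B K u v := by
  obtain ⟨a, b, s, h1, h2, h3, h4, h5⟩ := h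
  have hc : ∀ σ : Perm V, ct (e.permCongrHom σ) = ct σ := fun σ => ct_map e fun u => by
    simp [Equiv.permCongrHom]
  have hl : ∀ (σ : Perm V) (u : V), len (e.permCongrHom σ) (e u) = len σ u := fun σ u =>
    len_map e.injective (fun u => by simp [Equiv.permCongrHom]) u
  exact ⟨e.permCongrHom a, e.permCongrHom b, e s, by rw [hc, h1], by rw [hc, h2],
    by rw [← map_mul, hc, h3], by rw [hl, h4], by rw [hl, h5]⟩

lemma Pair.symm (h : Pair V A B K u v) : Pair V B A K v u := by
  obtain ⟨a, b, s, h1, h2, h3, h4, h5⟩ := h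
  exact ⟨b⁻¹, a⁻¹, s, by rw [ct_inv, h2], by rw [ct_inv, h1], by rw [← mul_inv_rev, ct_inv, h3],
    by rw [len_inv, h5], by rw [len_inv, h4]⟩

lemma Pair.add_point (h : Pair V A B K u v) :
    Pair (V ⊕ Fin 1) (1 ::ₘ A) (1 ::ₘ B) (1 ::ₘ K) 1 1 := by
  obtain ⟨a, b, s, h1, h2, h3, -, -⟩ := h
  have h : ∀ σ : Perm V, ct (φ σ (1 : Perm (Fin 1))) = 1 ::ₘ ct σ := fun σ => by
    rw [ct_φ, ct_one, add_comm]; rfl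
  exact ⟨φ a 1, φ b 1, Sum.inr 0, by rw [h, h1], by rw [h, h2], by rw [φ_mul, one_mul, h, h3],
    by rw [len_φ_inr, len_of_fixed (by simp)], by rw [len_φ_inr, len_of_fixed (by simp)]⟩

/-- Inserting a new point in a cycle of the first permutation. -/
lemma Pair.grow (h : Pair V (u ::ₘ A) B K u v) : ∃ K', nu K' = nu K + 1 ∧
    Pair (V ⊕ Fin 1) ((u + 1) ::ₘ A) (1 ::ₘ B) K' (u + 1) v ∧
    Pair (V ⊕ Fin 1) ((u + 1) ::ₘ A) (1 ::ₘ B) K' (u + 1) 1 := by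
  obtain ⟨a, b, s, h1, h2, h3, h4, h5⟩ := h
  have h : ct (φ b (1 : Perm (Fin 1))) = 1 ::ₘ ct b := by
    rw [ct_φ, ct_one, add_comm]; rfl
  have ht := ct_one_cons (le_refl 1) (0 : Fin 1)
  have h1t : len (1 : Perm (Fin 1)) 0 = 1 := len_of_fixed (by simp)
  have hA : ct (φ a (1 : Perm (Fin 1)) * sw s 0) = (u + 1) ::ₘ A := by
    rw [ct_glue_left (by rw [h1, h4]) ht, h4, h1t, Nat.sub_self, ones, Multiset.replicate_zero,
      add_zero]
  have hK : nu (ct ((φ a (1 : Perm (Fin 1)) * sw s 0) * φ b 1)) = nu K + 1 := by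
    have hs : (φ a (1 : Perm (Fin 1)) * sw s 0) * φ b 1 =
        φ (a * b) (1 : Perm (Fin 1)) * sw (b⁻¹ s) 0 := by
      have : sw s (0 : Fin 1) * φ b 1 = φ b 1 * sw (b⁻¹ s) 0 := by
        have := Equiv.mul_swap_eq_swap_mul (φ b (1 : Perm (Fin 1))) (Sum.inl (b⁻¹ s)) (Sum.inr 0)
        unfold sw
        rw [this]
        simp [φ]
      rw [mul_assoc, this, ← mul_assoc, φ_mul, one_mul]
    obtain ⟨M, hM⟩ := Multiset.exists_cons_of_mem (len_mem_ct (a * b) (b⁻¹ s))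
    have hpos := len_pos (a * b) (b⁻¹ s)
    rw [hs, ct_glue_left hM ht, ← h3, hM, h1t]
    simp only [nu_cons, nu_add, nu_replicate_one]
    omega
  refine ⟨_, hK, ⟨_, _, Sum.inl s, hA, by rw [h, h2], rfl, ?_, ?_⟩,
    ⟨_, _, Sum.inr 0, hA, by rw [h, h2], rfl, ?_, ?_⟩⟩
  · have := len_mul_swap_left (not_sameCycle_sumCongr a (1 : Perm (Fin 1)) s 0)
    rw [len_sumCongr_inl, len_sumCongr_inr, h4, h1t] at this
    exact this
  · rw [φ, len_sumCongr_inl, h5]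
  · rw [len_glue_left, h4, h1t]
  · rw [len_φ_inr, h1t]

lemma exists_one_mem {d : ℕ} {P Q : Multiset ℕ} (hP : Part d P) (hQ : Part d Q)
    (h : nu P + nu Q + 1 ≤ d) : 1 ∈ P ∨ 1 ∈ Q := by
  by_contra hc
  push Not at hc
  have aux : ∀ M, Part d M → 1 ∉ M → 2 * M.card ≤ d := by
    intro M hM h1
    have := Multiset.card_nsmul_le_sum (s := M) (a := 2) fun m hm => by
      have := hM.1 m hm
      have : m ≠ 1 := fun h => h1 (h ▸ hm)
      omega
    rw [hM.2, smul_eq_mul] at this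
    omega
  have := aux P hP hc.1
  have := aux Q hQ hc.2
  have := hP.nu_add_card
  have := hQ.nu_add_card
  omega

/-- The conclusion of the pair lemma in degree `d`. -/
def PairLemma (d : ℕ) : Prop :=
  ∀ (P Q : Multiset ℕ) (y z : ℕ), Part d P → Part d Q → y ∈ P → z ∈ Q → nu P + nu Q + 1 ≤ d →
    (y = 1 → z = 1 → d ≠ 1 → nu P + nu Q + 2 ≤ d) →
    ∃ K, nu K = nu P + nu Q ∧ Pair (Fin d) P Q K y z

/-- Adding one point to `Fin d`. -/
def sumFinOne (d : ℕ) : Fin d ⊕ Fin 1 ≃ Fin (d + 1) := finSumFinEquiv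

lemma PairLemma.two_le_one {d : ℕ} (H : PairLemma d) {P Q : Multiset ℕ} {y : ℕ}
    (hP : Part (d + 1) ((y + 2) ::ₘ P)) (hQ : Part (d + 1) (1 ::ₘ Q))
    (h : nu ((y + 2) ::ₘ P) + nu (1 ::ₘ Q) ≤ d) :
    ∃ K, nu K = nu ((y + 2) ::ₘ P) + nu (1 ::ₘ Q) ∧
      Pair (Fin (d + 1)) ((y + 2) ::ₘ P) (1 ::ₘ Q) K (y + 2) 1 := by
  obtain ⟨-, hP1, hP2⟩ := part_cons_iff.1 hP
  obtain ⟨-, hQ1, hQ2⟩ := part_cons_iff.1 hQ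
  have hP' : Part d ((y + 1) ::ₘ P) := part_cons (by omega) (by omega) hP2
  have hQ' : Part d Q := ⟨hQ2, by omega⟩
  simp only [nu_cons] at h ⊢
  have key : ∃ z ∈ Q, y + 1 = 1 → z = 1 → d ≠ 1 → nu ((y + 1) ::ₘ P) + nu Q + 2 ≤ d := by
    rcases Nat.eq_zero_or_pos (nu Q) with h0 | h0
    · obtain ⟨z, hz⟩ := hQ'.exists_mem (by omega)
      refine ⟨z, hz, fun hy _ hd => ?_⟩
      have := hP'.nu_add_card
      have : P ≠ 0 := by
        rintro rfl
        simp only [Multiset.sum_zero] at hP1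
        omega
      have := Multiset.card_pos.2 this
      simp only [Multiset.card_cons] at *
      omega
    · obtain ⟨z, hz, hz2⟩ := exists_two_le_of_nu_pos h0
      exact ⟨z, hz, by omega⟩
  obtain ⟨z, hz, hyz⟩ := key
  obtain ⟨K, hK, hp⟩ := H _ _ (y + 1) z hP' hQ' (by simp) hz (by simp only [nu_cons]; omega) hyz
  obtain ⟨K', hK', -, hp'⟩ := hp.grow
  refine ⟨K', ?_, hp'.map (sumFinOne d)⟩
  simp only [nu_cons] at hK
  omega

lemma PairLemma.two_le_two_le {d : ℕ} (H : PairLemma d) {P Q : Multiset ℕ} {y z : ℕ}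
    (hP : Part (d + 1) ((y + 2) ::ₘ P)) (hQ : Part (d + 1) (1 ::ₘ Q)) (hz : z ∈ Q) (hz2 : 2 ≤ z)
    (h : nu ((y + 2) ::ₘ P) + nu (1 ::ₘ Q) ≤ d) :
    ∃ K, nu K = nu ((y + 2) ::ₘ P) + nu (1 ::ₘ Q) ∧
      Pair (Fin (d + 1)) ((y + 2) ::ₘ P) (1 ::ₘ Q) K (y + 2) z := by
  obtain ⟨-, hP1, hP2⟩ := part_cons_iff.1 hP
  obtain ⟨-, hQ1, hQ2⟩ := part_cons_iff.1 hQ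
  have hP' : Part d ((y + 1) ::ₘ P) := part_cons (by omega) (by omega) hP2
  have hQ' : Part d Q := ⟨hQ2, by omega⟩
  simp only [nu_cons] at h ⊢
  obtain ⟨K, hK, hp⟩ := H _ _ (y + 1) z hP' hQ' (by simp) hz (by simp only [nu_cons]; omega)
    (by omega)
  obtain ⟨K', hK', hp', -⟩ := hp.grow
  refine ⟨K', ?_, hp'.map (sumFinOne d)⟩
  simp only [nu_cons] at hK
  omega

lemma mem_of_mem_cons_of_ne {a b : ℕ} {M : Multiset ℕ} (h : a ∈ b ::ₘ M) (hab : a ≠ b) : a ∈ M :=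
  (Multiset.mem_cons.1 h).resolve_left hab

theorem pairLemma (d : ℕ) : PairLemma d := by
  induction d with
  | zero => intro P Q y z _ _ _ _ h; omega
  | succ d H =>
    intro P Q y z hP hQ hy hz h hyz
    rcases Nat.eq_zero_or_pos (nu P + nu Q) with h0 | h0
    · have e1 := hP.eq_ones (by omega)
      have e2 := hQ.eq_ones (by omega)
      have hy1 : y = 1 := Multiset.eq_of_mem_replicate (e1 ▸ hy)
      have hz1 : z = 1 := Multiset.eq_of_mem_replicate (e2 ▸ hz)
      refine ⟨ones (d + 1), by simp [h0], 1, 1, 0, ?_, ?_, ?_, ?_, ?_⟩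
      · rw [ct_one, e1, Fintype.card_fin]
      · rw [ct_one, e2, Fintype.card_fin]
      · rw [mul_one, ct_one, Fintype.card_fin]
      · rw [hy1, len_of_fixed (by simp)]
      · rw [hz1, len_of_fixed (by simp)]
    obtain ⟨P, rfl⟩ := Multiset.exists_cons_of_mem hy
    obtain ⟨Q, rfl⟩ := Multiset.exists_cons_of_mem hz
    obtain ⟨hy0, hP1, hP2⟩ := part_cons_iff.1 hP
    obtain ⟨hz0, hQ1, hQ2⟩ := part_cons_iff.1 hQ
    by_cases hy1 : y = 1
    · by_cases hz1 : z = 1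
      · subst hy1 hz1
        simp only [nu_cons] at h h0 hyz ⊢
        have hP' : Part d P := ⟨hP2, by omega⟩
        have hQ' : Part d Q := ⟨hQ2, by omega⟩
        have key : ∃ y ∈ P, ∃ z ∈ Q, 2 ≤ y ∨ 2 ≤ z := by
          have := hyz trivial trivial (by omega)
          obtain ⟨y, hy⟩ := hP'.exists_mem (by omega)
          obtain ⟨z, hz⟩ := hQ'.exists_mem (by omega)
          rcases Nat.eq_zero_or_pos (nu P) with h3 | h3
          · obtain ⟨z, hz, hz2⟩ := exists_two_le_of_nu_pos (M := Q) (by omega)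
            exact ⟨y, hy, z, hz, Or.inr hz2⟩
          · obtain ⟨y, hy, hy2⟩ := exists_two_le_of_nu_pos h3
            exact ⟨y, hy, z, hz, Or.inl hy2⟩
        obtain ⟨y, hy, z, hz, h2⟩ := key
        have := hyz trivial trivial (by omega)
        obtain ⟨K, hK, hp⟩ := H P Q y z hP' hQ' hy hz (by omega) (by omega)
        exact ⟨1 ::ₘ K, by simp [hK], hp.add_point.map (sumFinOne d)⟩
      · subst hy1
        obtain ⟨z, rfl⟩ := Nat.exists_eq_add_of_le' (show 2 ≤ z by omega)
        obtain ⟨K, hK, hp⟩ := H.two_le_one hQ hP (by omega)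
        exact ⟨K, by omega, hp.symm⟩
    · by_cases hz1 : z = 1
      · subst hz1
        obtain ⟨y, rfl⟩ := Nat.exists_eq_add_of_le' (show 2 ≤ y by omega)
        obtain ⟨K, hK, hp⟩ := H.two_le_one hP hQ (by omega)
        exact ⟨K, by omega, hp⟩
      · rcases exists_one_mem hP hQ h with h1 | h1
        · obtain ⟨z, rfl⟩ := Nat.exists_eq_add_of_le' (show 2 ≤ z by omega)
          obtain ⟨P', rfl⟩ := Multiset.exists_cons_of_mem (mem_of_mem_cons_of_ne h1 (Ne.symm hy1))
          rw [Multiset.cons_swap] at *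
          obtain ⟨K, hK, hp⟩ := H.two_le_two_le hQ hP (z := y) (by simp) (by omega) (by omega)
          exact ⟨K, by omega, hp.symm⟩
        · obtain ⟨y, rfl⟩ := Nat.exists_eq_add_of_le' (show 2 ≤ y by omega)
          obtain ⟨Q', rfl⟩ := Multiset.exists_cons_of_mem (mem_of_mem_cons_of_ne h1 (Ne.symm hz1))
          rw [Multiset.cons_swap z] at *
          obtain ⟨K, hK, hp⟩ := H.two_le_two_le hP hQ (z := z) (by simp) (by omega) (by omega)
          exact ⟨K, by omega, hp⟩

lemma exists_mul_nu {d : ℕ} {P Q : Multiset ℕ} (hP : Part d P) (hQ : Part d Q)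
    (h : nu P + nu Q + 1 ≤ d) : ∃ y z, ∃ K, nu K = nu P + nu Q ∧ Pair (Fin d) P Q K y z := by
  obtain ⟨y, hy⟩ := hP.exists_mem (by omega)
  obtain ⟨z, hz⟩ := hQ.exists_mem (by omega)
  rcases Nat.eq_zero_or_pos (nu P) with h3 | h3
  · rcases Nat.eq_zero_or_pos (nu Q) with h4 | h4
    · exact ⟨y, z, pairLemma d P Q y z hP hQ hy hz h (by omega)⟩
    · obtain ⟨z, hz, hz2⟩ := exists_two_le_of_nu_pos h4
      exact ⟨y, z, pairLemma d P Q y z hP hQ hy hz h (by omega)⟩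
  · obtain ⟨y, hy, hy2⟩ := exists_two_le_of_nu_pos h3
    exact ⟨y, z, pairLemma d P Q y z hP hQ hy hz h (by omega)⟩

/-- Permutations of prescribed types with small total ramification can be chosen so that the
ramification of the product is the total ramification. -/
theorem exists_list_nu {d : ℕ} (O : List (Multiset ℕ)) :
    (∀ M ∈ O, Part d M) → (O.map nu).sum + 1 ≤ d →
    ∃ L : List (Perm (Fin d)), L.map ct = O ∧ nu (ct L.prod) = (O.map nu).sum := by
  induction O with
  | nil => exact fun _ _ => ⟨[], rfl, by simp [ct_one]⟩
  | cons M O ih =>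
    intro hO h
    simp only [List.mem_cons, forall_eq_or_imp, List.map_cons, List.sum_cons] at hO h ⊢
    obtain ⟨L, rfl, hL⟩ := ih hO.2 (by omega)
    have hp := part_ct L.prod
    rw [Fintype.card_fin] at hp
    obtain ⟨-, -, K, hK, a, b, -, rfl, hb, rfl, -, -⟩ := exists_mul_nu hO.1 hp (by omega)
    obtain ⟨g, hg⟩ := exists_conj_of_ct_eq hb
    refine ⟨(g * a * g⁻¹) :: L, by simp [ct_conj], ?_⟩
    rw [List.prod_cons, ← hg, show g * a * g⁻¹ * (g * b * g⁻¹) = g * (a * b) * g⁻¹ by group,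
      ct_conj, hK, hL]

lemma meet_of_card_eq_one {d : ℕ} {O : List (Multiset ℕ)} {P Q : Multiset ℕ} {y x : ℕ}
    (hO : ∀ M ∈ O, Part d M) (hP : Part d P) (hQ : Part d Q) (hQ1 : Q.card = 1)
    (hs : (O.map nu).sum + nu P + 1 = d) (hy : y ∈ P) (hx : x ∈ Q) : Meet (Fin d) O P Q y x := by
  obtain ⟨L', hL', hnu⟩ := exists_list_nu (O ++ [P]) (by
    intro M hM
    rcases List.mem_append.1 hM with h | h
    · exact hO M h
    · rw [List.mem_singleton.1 h]; exact hP) (by simp; omega)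
  obtain ⟨L, L1, rfl, rfl, hc⟩ := List.map_eq_append_iff.1 hL'
  obtain ⟨a, rfl, rfl⟩ := List.map_eq_singleton_iff.1 hc
  simp only [List.prod_append, List.prod_cons, List.prod_nil, mul_one, List.map_append,
    List.map_cons, List.map_nil, List.sum_append, List.sum_cons, List.sum_nil, add_zero] at hnu
  have hb := nu_ct_add_card (L.prod * a)
  rw [Fintype.card_fin] at hb
  have one : ∀ M, Part d M → M.card = 1 → M = {d} := by
    intro M hM h1
    obtain ⟨m, rfl⟩ := Multiset.card_eq_one.1 h1
    have := hM.2
    simp at this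
    rw [this]
  have hpb := part_ct (L.prod * a)⁻¹
  rw [Fintype.card_fin] at hpb
  have hb1 := one _ hpb (by rw [ct_inv]; omega)
  rw [one Q hQ hQ1] at hx ⊢
  have hl : ∀ t, len (L.prod * a)⁻¹ t = d := fun t => by
    have := len_mem_ct (L.prod * a)⁻¹ t
    rw [hb1] at this
    exact Multiset.mem_singleton.1 this
  obtain ⟨s, hs⟩ := exists_len_eq hy
  refine ⟨L, a, (L.prod * a)⁻¹, s, rfl, rfl, hb1, by simp, fun f hf u v hu => ?_, hs, ?_⟩
  · exact (hf (L.prod * a)⁻¹ (by simp)).of_len_eq_card ((hl u).trans (Fintype.card_fin d).symm) hu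
  · rw [hl, Multiset.mem_singleton.1 hx]

end PairLemma

section Induction

/-- The numerical hypotheses of the inductive statement. -/
structure Adm (d : ℕ) (O : List (Multiset ℕ)) (P Q : Multiset ℕ) : Prop where
  part_O : ∀ M ∈ O, Part d M
  part_P : Part d P
  part_Q : Part d Q
  nu_O : ∀ M ∈ O, 1 ≤ nu M
  nu_P : 1 ≤ nu P
  sum_eq : (O.map nu).sum + nu P + 2 = d + Q.card
  card_le : Q.card ≤ O.length

lemma Adm.perm {d : ℕ} {O O' : List (Multiset ℕ)} {P Q : Multiset ℕ} (h : Adm d O P Q)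
    (hO : O.Perm O') : Adm d O' P Q where
  part_O M hM := h.part_O M (hO.mem_iff.2 hM)
  part_P := h.part_P
  part_Q := h.part_Q
  nu_O M hM := h.nu_O M (hO.mem_iff.2 hM)
  nu_P := h.nu_P
  sum_eq := by rw [← (hO.map nu).sum_eq]; exact h.sum_eq
  card_le := hO.length_eq ▸ h.card_le

lemma Adm.swap {d : ℕ} {O : List (Multiset ℕ)} {C P Q : Multiset ℕ} (h : Adm d (C :: O) P Q) :
    Adm d (P :: O) C Q := by
  obtain ⟨h1, h2, h3, h4, h5, h6, h7⟩ := h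
  simp only [List.mem_cons, forall_eq_or_imp, List.map_cons, List.sum_cons] at h1 h4 h6
  refine ⟨?_, h1.1, h3, ?_, h4.1, ?_, by simpa using h7⟩
  · simp only [List.mem_cons, forall_eq_or_imp]; exact ⟨h2, h1.2⟩
  · simp only [List.mem_cons, forall_eq_or_imp]; exact ⟨h5, h4.2⟩
  · simp only [List.map_cons, List.sum_cons]; omega

/-- The realizability statement for all admissible data of complexity less than `N`. -/
def Below (N : ℕ) : Prop :=
  ∀ d O P Q y x, d + O.length < N → Adm d O P Q → y ∈ P → x ∈ Q → Meet (Fin d) O P Q y x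

lemma exists_map_add_ones {d p : ℕ} {O : List (Multiset ℕ)} (hO : ∀ l ∈ O, ones p ≤ l)
    (h : ∀ l ∈ O, Part d l) (hν : ∀ l ∈ O, 1 ≤ nu l) :
    ∃ O' : List (Multiset ℕ), O = O'.map (· + ones p) ∧ (∀ l ∈ O', Part (d - p) l) ∧
      (∀ l ∈ O', 1 ≤ nu l) ∧ (O'.map nu).sum = (O.map nu).sum ∧ O'.length = O.length := by
  induction O with
  | nil => exact ⟨[], by simp⟩
  | cons M O ih =>
    simp only [List.mem_cons, forall_eq_or_imp] at hO h hν
    obtain ⟨O', rfl, h1, h2, h3, h4⟩ := ih hO.2 h.2 hν.2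
    obtain ⟨M', rfl⟩ := Multiset.le_iff_exists_add.1 hO.1
    refine ⟨M' :: O', by simp [add_comm], ?_, ?_, by simpa using h3, by simp⟩
    · simp only [List.mem_cons, forall_eq_or_imp]
      refine ⟨⟨fun m hm => h.1.1 m (by simp [hm]), ?_⟩, h1⟩
      have := h.1.2
      simp at this
      omega
    · simp only [List.mem_cons, forall_eq_or_imp]
      exact ⟨by simpa using hν.1, h2⟩

lemma add_ones_sub {A : Multiset ℕ} {p : ℕ} (h : ones p ≤ A) :
    ∃ A', A = A' + ones p ∧ A.sum = A'.sum + p ∧ nu A = nu A' ∧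
      ((∀ m ∈ A, 1 ≤ m) → ∀ m ∈ A', 1 ≤ m) := by
  obtain ⟨A', rfl⟩ := Multiset.le_iff_exists_add.1 h
  exact ⟨A', add_comm _ _, by simp [add_comm], by simp, fun h m hm => h m (by simp [hm])⟩

lemma Meet3.toMeets {d p : ℕ} {O : List (Multiset ℕ)} {C A Q : Multiset ℕ} {z y x : ℕ} (hp : p ≤ d)
    (h : Meet3 (Fin (d - p) ⊕ Fin p) O C A Q z y x) :
    Meet (Fin d) (C :: O) A Q y x ∧ Meet (Fin d) (A :: O) C Q z x := by
  have e : Fin (d - p) ⊕ Fin p ≃ Fin d := finSumFinEquiv.trans (finCongr (by omega))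
  exact ⟨h.toMeet.map e, h.toMeet'.map e⟩

variable {d N p w x y z : ℕ} {O : List (Multiset ℕ)} {A B C J P Q : Multiset ℕ}

lemma Below.step_pq (H : Below N) (h : Adm d ((p ::ₘ C) :: O) ((y + 2) ::ₘ A) (x ::ₘ Q))
    (hN : d + O.length + 1 ≤ N) (hO : ∀ l ∈ O, ones p ≤ l) (hA : ones (p - 1) ≤ A)
    (hC : 1 ≤ nu C) (hA2 : 2 ≤ nu ((y + 2) ::ₘ A)) (hpx : p < x) :
    Meet (Fin d) ((p ::ₘ C) :: O) ((y + 2) ::ₘ A) (x ::ₘ Q) (y + 2) x ∧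
      Meet (Fin d) (((y + 2) ::ₘ A) :: O) (p ::ₘ C) (x ::ₘ Q) p x := by
  obtain ⟨h1, h2, h3, h4, h5, h6, h7⟩ := h
  simp only [List.mem_cons, forall_eq_or_imp, List.map_cons, List.sum_cons, part_cons_iff, nu_cons,
    Multiset.card_cons, List.length_cons] at h1 h2 h3 h4 h5 h6 h7 hA2
  obtain ⟨⟨hp, hC1, hC2⟩, h1⟩ := h1
  obtain ⟨O', rfl, k1, k2, k3, k4⟩ := exists_map_add_ones hO h1 h4.2
  obtain ⟨A', rfl, a1, a2, a3⟩ := add_ones_sub hA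
  obtain ⟨x, rfl⟩ := Nat.exists_eq_add_of_lt hpx
  have hadm : Adm (d - p) (C :: O') ((y + 1) ::ₘ A') ((x + 1) ::ₘ Q) := by
    refine ⟨?_, part_cons (by omega) (by omega) (a3 h2.2.2), part_cons (by omega) (by omega) h3.2.2,
      ?_, ?_, ?_, ?_⟩
    · simp only [List.mem_cons, forall_eq_or_imp]
      exact ⟨⟨hC2, by omega⟩, k1⟩
    · simp only [List.mem_cons, forall_eq_or_imp]
      exact ⟨hC, k2⟩
    · simp only [nu_cons]; omega
    · simp only [List.map_cons, List.sum_cons, nu_cons, Multiset.card_cons]; omega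
    · simp only [List.length_cons, Multiset.card_cons]; omega
  have := ((H _ _ _ _ (y + 1) (x + 1) (by simp only [List.length_cons]; omega) hadm (by simp)
    (by simp)).glue_pq hp).toMeets (by omega)
  rwa [show x + 1 + p = p + x + 1 by omega] at this

lemma Below.step_cp (H : Below N) (h : Adm d (((z + x) ::ₘ C) :: O) ((y + 2) ::ₘ A) (x ::ₘ Q))
    (hN : d + O.length + 1 ≤ N) (hO : ∀ l ∈ O, ones x ≤ l) (hA : ones (x - 1) ≤ A)
    (hz : 1 ≤ z) (hA2 : 2 ≤ nu ((y + 2) ::ₘ A))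
    (hb : nu ((z + x) ::ₘ C) + nu ((y + 2) ::ₘ A) + 1 ≤ d) :
    Meet (Fin d) (((z + x) ::ₘ C) :: O) ((y + 2) ::ₘ A) (x ::ₘ Q) (y + 2) x := by
  obtain ⟨h1, h2, h3, h4, h5, h6, h7⟩ := h
  simp only [List.mem_cons, forall_eq_or_imp, List.map_cons, List.sum_cons, part_cons_iff, nu_cons,
    Multiset.card_cons, List.length_cons] at h1 h2 h3 h4 h5 h6 h7 hA2 hb
  obtain ⟨⟨hp, hC1, hC2⟩, h1⟩ := h1
  obtain ⟨O', rfl, k1, k2, k3, k4⟩ := exists_map_add_ones hO h1 h4.2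
  obtain ⟨A', rfl, a1, a2, a3⟩ := add_ones_sub hA
  have hA' : Part (d - x) ((y + 1) ::ₘ A') := part_cons (by omega) (by omega) (a3 h2.2.2)
  have hC' : Part (d - x) (z ::ₘ C) := part_cons (by omega) (by omega) hC2
  obtain ⟨K, hK, hpair⟩ := pairLemma (d - x) _ _ z (y + 1) hC' hA' (by simp) (by simp)
    (by simp only [nu_cons]; omega) (by simp only [nu_cons]; omega)
  simp only [nu_cons] at hK
  have hKp : Part (d - x) K := by
    obtain ⟨a, b, -, -, -, rfl, -, -⟩ := hpair
    simpa using part_ct (a * b)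
  have hKn := hKp.nu_add_card
  have hQ' : Part (d - x) Q := ⟨h3.2.2, by omega⟩
  have hadm : Adm (d - x) O' K Q := ⟨k1, hKp, hQ', k2, by omega, by omega, by omega⟩
  obtain ⟨y', hy'⟩ := hKp.exists_mem (by omega)
  obtain ⟨x', hx'⟩ := hQ'.exists_mem (by omega)
  exact ((((H _ _ _ _ y' x' (by omega) hadm hy' hx').split_left hpair).glue_cp h3.1).toMeets
    (by omega)).1

lemma Below.step_pl (H : Below N)
    (h : Adm d ((p ::ₘ C) :: ((w + 2) ::ₘ B) :: O) ((y + 2) ::ₘ A) (p ::ₘ Q))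
    (hN : d + O.length + 2 ≤ N) (hO : ∀ l ∈ O, ones p ≤ l) (hA : ones (p - 1) ≤ A)
    (hB : ones (p - 1) ≤ B) (hC : 1 ≤ nu C) (hA2 : 2 ≤ nu ((y + 2) ::ₘ A))
    (hb : nu ((y + 2) ::ₘ A) + nu ((w + 2) ::ₘ B) + p ≤ d) :
    Meet (Fin d) ((p ::ₘ C) :: ((w + 2) ::ₘ B) :: O) ((y + 2) ::ₘ A) (p ::ₘ Q) (y + 2) p ∧
      Meet (Fin d) (((y + 2) ::ₘ A) :: ((w + 2) ::ₘ B) :: O) (p ::ₘ C) (p ::ₘ Q) p p := by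
  obtain ⟨h1, h2, h3, h4, h5, h6, h7⟩ := h
  simp only [List.mem_cons, forall_eq_or_imp, List.map_cons, List.sum_cons, part_cons_iff, nu_cons,
    Multiset.card_cons, List.length_cons] at h1 h2 h3 h4 h5 h6 h7 hA2 hb
  obtain ⟨⟨hp, hC1, hC2⟩, ⟨-, hB1, hB2⟩, h1⟩ := h1
  obtain ⟨O', rfl, k1, k2, k3, k4⟩ := exists_map_add_ones hO h1 h4.2.2
  obtain ⟨A', rfl, a1, a2, a3⟩ := add_ones_sub hA
  obtain ⟨B', rfl, b1, b2, b3⟩ := add_ones_sub hB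
  have hA' : Part (d - p) ((y + 1) ::ₘ A') := part_cons (by omega) (by omega) (a3 h2.2.2)
  have hB' : Part (d - p) ((w + 1) ::ₘ B') := part_cons (by omega) (by omega) (b3 hB2)
  obtain ⟨K, hK, hpair⟩ := pairLemma (d - p) _ _ (y + 1) (w + 1) hA' hB' (by simp) (by simp)
    (by simp only [nu_cons]; omega) (by simp only [nu_cons]; omega)
  simp only [nu_cons] at hK
  have hKp : Part (d - p) K := by
    obtain ⟨a, b, -, -, -, rfl, -, -⟩ := hpair
    simpa using part_ct (a * b)
  have hKn := hKp.nu_add_card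
  have hQ' : Part (d - p) Q := ⟨h3.2.2, by omega⟩
  have hadm : Adm (d - p) (C :: O') K Q := by
    refine ⟨?_, hKp, hQ', ?_, by omega, ?_, by simp only [List.length_cons]; omega⟩
    · simp only [List.mem_cons, forall_eq_or_imp]
      exact ⟨⟨hC2, by omega⟩, k1⟩
    · simp only [List.mem_cons, forall_eq_or_imp]
      exact ⟨hC, k2⟩
    · simp only [List.map_cons, List.sum_cons]; omega
  obtain ⟨y', hy'⟩ := hKp.exists_mem (by omega)
  obtain ⟨x', hx'⟩ := hQ'.exists_mem (by omega)
  exact (((H _ _ _ _ y' x' (by simp only [List.length_cons]; omega) hadm hy' hx').split_left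
    hpair).glue_pl hp).toMeets (by omega)

end Induction

section Main

lemma sum_le_two_mul_nu_add_count {M : Multiset ℕ} (h : ∀ m ∈ M, 1 ≤ m) :
    M.sum ≤ 2 * nu M + M.count 1 := by
  induction M using Multiset.induction_on with
  | empty => simp
  | cons m M ih =>
    simp only [Multiset.mem_cons, forall_eq_or_imp] at h
    have := ih h.2
    simp only [Multiset.sum_cons, nu_cons, Multiset.count_cons]
    split_ifs with hm <;> omega

lemma ones_le_iff {p : ℕ} {M : Multiset ℕ} : ones p ≤ M ↔ p ≤ M.count 1 :=
  Multiset.le_count_iff_replicate_le.symm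

lemma ones_one_le_iff {M : Multiset ℕ} : ones 1 ≤ M ↔ 1 ∈ M := by
  rw [ones_le_iff, Multiset.one_le_count_iff_mem]

lemma exists_min_mem {M : Multiset ℕ} {m : ℕ} (h : m ∈ M) : ∃ p ∈ M, ∀ k ∈ M, p ≤ k := by
  classical
  have hex : ∃ p, p ∈ M := ⟨m, h⟩
  exact ⟨Nat.find hex, Nat.find_spec hex, fun k hk => Nat.find_min' hex hk⟩

variable {d N w p x y z : ℕ} {O : List (Multiset ℕ)} {A B C J P Q : Multiset ℕ}

lemma nu_le_sum {l : Multiset ℕ} (h : l ∈ O) : nu l ≤ (O.map nu).sum :=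
  List.single_le_sum (fun _ _ => Nat.zero_le _) _ (List.mem_map_of_mem h)

lemma Adm.exists_split (h : Adm d O ((y + 2) ::ₘ A) Q) (hQ : 2 ≤ Q.card)
    (hO : ∀ M ∈ O, Q.card ≤ nu M) (hP : Q.card ≤ nu ((y + 2) ::ₘ A)) :
    ∃ p C O', O.Perm ((p ::ₘ C) :: O') ∧ (∀ l ∈ O', ones p ≤ l) ∧ ones (p - 1) ≤ A ∧ 1 ≤ nu C := by
  by_cases hc : ∃ M ∈ O, 1 ∉ M
  · obtain ⟨j, hj, h1⟩ := hc
    have hperm := List.perm_cons_erase hj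
    set O' := O.erase j
    have h' := h.perm hperm
    have hj' := h.part_O j hj
    have hjn := hj'.nu_add_card
    have hsum := h'.sum_eq
    have hlen := h'.card_le
    simp only [List.map_cons, List.sum_cons, List.length_cons] at hsum hlen
    have hO' : ∀ l ∈ O', Q.card ≤ nu l := fun l hl => hO l (hperm.mem_iff.2 (by simp [hl]))
    obtain ⟨m, hm⟩ := exists_two_le_of_nu_pos (h.nu_O j hj)
    obtain ⟨p, hp, hmin⟩ := exists_min_mem hm.1
    have hp2 : 2 ≤ p := by
      have := hj'.1 p hp
      have : p ≠ 1 := fun h => h1 (h ▸ hp)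
      omega
    obtain ⟨C, rfl⟩ := Multiset.exists_cons_of_mem hp
    have hpn := Multiset.card_nsmul_le_sum hmin
    rw [hj'.2, smul_eq_mul] at hpn
    have key : ∀ M, Part d M → nu M + 2 ≤ (p ::ₘ C).card → p ≤ M.count 1 := by
      intro M hM hn
      have := sum_le_two_mul_nu_add_count hM.1
      rw [hM.2] at this
      obtain ⟨q, rfl⟩ := Nat.exists_eq_add_of_le hp2
      obtain ⟨n, hn'⟩ := Nat.exists_eq_add_of_le hn
      rw [hn'] at hpn
      nlinarith [Nat.zero_le (q * nu M), Nat.zero_le (q * n)]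
    obtain ⟨l, hl⟩ : ∃ l, l ∈ O' := List.exists_mem_of_length_pos (by omega)
    have hlr := hO' l hl
    have hls := nu_le_sum hl
    have hPn : nu ((y + 2) ::ₘ A) + 2 ≤ (p ::ₘ C).card := by omega
    refine ⟨p, C, O', hperm, fun l hl => ones_le_iff.2 (key l ?_ ?_), ?_, ?_⟩
    · exact h'.part_O l (by simp [hl])
    · have := nu_le_sum hl
      omega
    · have := key _ h.part_P hPn
      rw [Multiset.count_cons_of_ne (by omega)] at this
      exact ones_le_iff.2 (by omega)
    · obtain ⟨c, hc⟩ : ∃ c, c ∈ C := Multiset.card_pos_iff_exists_mem.1 (by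
        rw [Multiset.card_cons] at hPn; omega)
      have := le_nu_of_mem hc
      have := hmin c (by simp [hc])
      omega
  · push Not at hc
    have hlen := h.card_le
    obtain ⟨j, O', rfl⟩ := List.exists_cons_of_length_pos (l := O) (by omega)
    obtain ⟨C, hC⟩ := Multiset.exists_cons_of_mem (hc j (by simp))
    refine ⟨1, C, O', by rw [hC], fun l hl => ones_one_le_iff.2 (hc l (by simp [hl])), by simp, ?_⟩
    have := h.nu_O j (by simp)
    simpa [hC] using this

lemma ones_sub_le_of_le_cons (h : ones p ≤ z ::ₘ B) : ones (p - 1) ≤ B := by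
  rw [ones_le_iff] at h ⊢
  rw [Multiset.count_cons] at h
  split_ifs at h <;> omega

lemma exists_add_two_cons {M : Multiset ℕ} (h : 1 ≤ nu M) : ∃ w B, M = (w + 2) ::ₘ B := by
  obtain ⟨m, hm, hm2⟩ := exists_two_le_of_nu_pos h
  obtain ⟨B, rfl⟩ := Multiset.exists_cons_of_mem hm
  exact ⟨m - 2, B, by rw [Nat.sub_add_cancel hm2]⟩

lemma Below.of_two_le (H : Below N) (hN : d + O.length = N) (h : Adm d O ((y + 2) ::ₘ A) (x ::ₘ Q))
    (hQ : 2 ≤ (x ::ₘ Q).card) (hO : ∀ M ∈ O, (x ::ₘ Q).card ≤ nu M)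
    (hP : (x ::ₘ Q).card ≤ nu ((y + 2) ::ₘ A)) :
    Meet (Fin d) O ((y + 2) ::ₘ A) (x ::ₘ Q) (y + 2) x := by
  obtain ⟨p, C, O', hperm, hO', hA, hC⟩ := h.exists_split hQ hO hP
  refine Meet.perm ?_ hperm.symm
  have h' := h.perm hperm
  have hsum := h'.sum_eq
  have hlen := h'.card_le
  have hlen' := hperm.length_eq
  simp only [List.map_cons, List.sum_cons, List.length_cons] at hsum hlen hlen'
  have hp : 1 ≤ p := (h'.part_O _ List.mem_cons_self).1 p (by simp)
  obtain ⟨l, O'', rfl⟩ := List.exists_cons_of_length_pos (l := O') (by omega)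
  have hl := hO l (hperm.mem_iff.2 (by simp))
  simp only [List.map_cons, List.sum_cons, List.length_cons] at hsum hlen hlen'
  rcases lt_trichotomy p x with hpx | rfl | hpx
  · exact (H.step_pq h' (by simp only [List.length_cons]; omega) hO' hA hC (by omega) hpx).1
  · obtain ⟨w, B, rfl⟩ := exists_add_two_cons (M := l) (by omega)
    refine (H.step_pl h' (by omega) (fun l hl => hO' l (by simp [hl])) hA
      (ones_sub_le_of_le_cons (hO' ((w + 2) ::ₘ B) (by simp))) hC (by omega) ?_).1
    rw [nu_cons p C] at hsum
    rcases O'' with _ | ⟨b, L⟩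
    · simp only [List.length_nil, List.map_nil, List.sum_nil] at hsum hlen
      omega
    · have h1 := hO b (hperm.mem_iff.2 (by simp))
      have h2 := nu_le_sum (O := b :: L) (l := b) (by simp)
      omega
  · obtain ⟨z, rfl⟩ := Nat.exists_eq_add_of_lt hpx
    rw [show x + z + 1 = (z + 1) + x by omega] at *
    refine H.step_cp h' (by simp only [List.length_cons]; omega) (fun l hl => ?_) ?_ (by omega)
      (by omega) (by omega)
    · have := hO' l hl
      rw [ones_le_iff] at this ⊢
      omega
    · rw [ones_le_iff] at hA ⊢
      omega

lemma Below.of_one (H : Below N) (hN : d + O.length = N) (h : Adm d O (1 ::ₘ A) (x ::ₘ Q))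
    (hQ : 2 ≤ (x ::ₘ Q).card) (hO : ∀ M ∈ O, (x ::ₘ Q).card ≤ nu M)
    (hP : (x ::ₘ Q).card ≤ nu (1 ::ₘ A) + 1) :
    Meet (Fin d) O (1 ::ₘ A) (x ::ₘ Q) 1 x := by
  have hlen := h.card_le
  obtain ⟨j, O', hperm, hO'⟩ : ∃ j O', O.Perm (j :: O') ∧ ∀ l ∈ O', ones 1 ≤ l := by
    by_cases hc : ∃ M ∈ O, 1 ∉ M
    · obtain ⟨j, hj, h1⟩ := hc
      have hperm := List.perm_cons_erase hj
      refine ⟨j, _, hperm, fun l hl => ones_one_le_iff.2 ?_⟩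
      have h' := h.perm hperm
      have hsum := h'.sum_eq
      have := nu_le_sum hl
      simp only [List.map_cons, List.sum_cons] at hsum
      exact (exists_one_mem (h.part_O j hj) (h'.part_O l (by simp [hl])) (by omega)).resolve_left h1
    · push Not at hc
      obtain ⟨j, O', rfl⟩ := List.exists_cons_of_length_pos (l := O) (by omega)
      exact ⟨j, O', .refl _, fun l hl => ones_one_le_iff.2 (hc l (by simp [hl]))⟩
  refine Meet.perm ?_ hperm.symm
  have hj := hO j (hperm.mem_iff.2 (by simp))
  obtain ⟨z, B, rfl⟩ := exists_add_two_cons (M := j) (by omega)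
  have h' := (h.perm hperm).swap
  have hsum := h'.sum_eq
  have hlen' := hperm.length_eq
  have hA := h.nu_P
  rw [nu_cons] at hA
  simp only [List.map_cons, List.sum_cons, List.length_cons] at hsum hlen'
  have hx : 1 ≤ x := h.part_Q.1 x (by simp)
  rcases hx.lt_or_eq with hx | rfl
  · exact (H.step_pq h' (by omega) hO' (by simp) (by omega) (by omega) hx).2
  · obtain ⟨l, O'', rfl⟩ := List.exists_cons_of_length_pos (l := O') (by omega)
    have hl := hO l (hperm.mem_iff.2 (by simp))
    simp only [List.map_cons, List.sum_cons, List.length_cons] at hsum hlen'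
    obtain ⟨w, B, rfl⟩ := exists_add_two_cons (M := l) (by omega)
    exact (H.step_pl h' (by omega) (fun l hl => hO' l (by simp [hl])) (by simp) (by simp) (by omega)
      (by omega) (by omega)).2

theorem Adm.meet (h : Adm d O P Q) (hy : y ∈ P) (hx : x ∈ Q) : Meet (Fin d) O P Q y x := by
  induction hN : d + O.length using Nat.strong_induction_on generalizing d O P Q y x with
  | _ N ih =>
  have H : Below N := fun d O P Q y x hlt hadm hy hx => ih _ hlt hadm hy hx rfl
  have hQ := h.part_Q.nu_add_card
  have hP := h.part_P.nu_add_card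
  have hsum := h.sum_eq
  have hlen := h.card_le
  have hQ0 : 0 < Q.card := Multiset.card_pos_iff_exists_mem.2 ⟨x, hx⟩
  by_cases hQ1 : Q.card = 1
  · exact meet_of_card_eq_one h.part_O h.part_P h.part_Q hQ1 (by omega) hy hx
  have hK : ∀ {A B K : Multiset ℕ} {u v : ℕ}, Pair (Fin d) A B K u v → Part d K := by
    rintro A B K u v ⟨a, b, -, -, -, rfl, -, -⟩
    simpa using part_ct (a * b)
  by_cases hc : ∃ j ∈ O, nu j + 1 ≤ Q.card
  · obtain ⟨j, hj, hjr⟩ := hc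
    have hperm := List.perm_cons_erase hj
    refine Meet.perm ?_ hperm.symm
    have h' := h.perm hperm
    have hsum := h'.sum_eq
    have hlen' := hperm.length_eq
    have hj1 := h.nu_O j hj
    simp only [List.map_cons, List.sum_cons, List.length_cons] at hsum hlen'
    obtain ⟨z, hz, hz2⟩ := exists_two_le_of_nu_pos hj1
    obtain ⟨K, hKn, hp⟩ := pairLemma d j Q z x (h.part_O j hj) h.part_Q hz hx (by omega)
      (by omega)
    have hKc := (hK hp).nu_add_card
    refine Meet.split_meet (fun w hw => ih _ (by omega) ?_ hy hw rfl) hp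
    exact ⟨fun M hM => h'.part_O M (by simp [hM]), h.part_P, hK hp,
      fun M hM => h'.nu_O M (by simp [hM]), h.nu_P, by omega, by omega⟩
  push Not at hc
  have hO : ∀ M ∈ O, Q.card ≤ nu M := fun M hM => by have := hc M hM; omega
  by_cases hc' : nu P + 1 ≤ Q.card ∧ ¬ (x = 1 ∧ y = 1 ∧ nu P + 1 = Q.card)
  · obtain ⟨hPr, hne⟩ := hc'
    obtain ⟨P', O', rfl⟩ := List.exists_cons_of_length_pos (l := O) (by omega)
    have hP1 := h.nu_P
    have hO1 := h.nu_O
    have hO2 := h.part_O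
    simp only [List.map_cons, List.sum_cons, List.length_cons, List.mem_cons, forall_eq_or_imp]
      at hsum hlen hN hO1 hO2
    obtain ⟨K, hKn, hp⟩ := pairLemma d P Q y x h.part_P h.part_Q hy hx (by omega) (by omega)
    have hKc := (hK hp).nu_add_card
    obtain ⟨y', hy'⟩ := hO2.1.exists_mem (by omega)
    obtain ⟨x', hx'⟩ := (hK hp).exists_mem (by omega)
    refine Meet.split_right (ih _ (by omega) ?_ hy' hx' rfl) hp
    exact ⟨hO2.2, hO2.1, hK hp, hO1.2, hO1.1, by omega, by omega⟩
  have hy1 := h.part_P.1 y hy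
  obtain ⟨A, rfl⟩ := Multiset.exists_cons_of_mem hy
  obtain ⟨R, rfl⟩ := Multiset.exists_cons_of_mem hx
  rcases hy1.lt_or_eq with hy2 | rfl
  · obtain ⟨t, rfl⟩ : ∃ t, y = t + 2 := ⟨y - 2, by omega⟩
    exact H.of_two_le hN h (by omega) hO (by omega)
  · exact H.of_one hN h (by omega) hO (by omega)

end Main

section Realizable

lemma exists_ofFn_eq {X : Type*} {k : ℕ} {L : List X} (h : L.length = k) :
    ∃ α : Fin k → X, List.ofFn α = L := by
  subst h
  exact ⟨L.get, List.ofFn_get L⟩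

lemma ct_eq_fullCycleType {d : ℕ} (σ : Perm (Fin d)) : ct σ = fullCycleType σ := by
  rw [ct, fullCycleType, Fintype.card_fin]

lemma Tr.exists_mem_closure {V : Type} {L : List (Perm V)} (h : Tr L) (x y : V) :
    ∃ g ∈ Subgroup.closure {σ | σ ∈ L}, g x = y := by
  refine h (fun v => ∃ g ∈ Subgroup.closure {σ | σ ∈ L}, g x = v) (fun a ha u => ?_) x y
    ⟨1, one_mem _, rfl⟩
  have ha' : a ∈ Subgroup.closure {σ | σ ∈ L} := Subgroup.subset_closure ha
  constructor
  · rintro ⟨g, hg, h⟩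
    exact ⟨a⁻¹ * g, mul_mem (inv_mem ha') hg, by simp [h]⟩
  · rintro ⟨g, hg, rfl⟩
    exact ⟨a * g, mul_mem ha' hg, rfl⟩

lemma realizable_of_meet {d m y x : ℕ} {π : Fin (m + 2) → Multiset ℕ}
    (h : Meet (Fin d) (List.ofFn fun i : Fin m => π i.castSucc.castSucc) (π (Fin.last m).castSucc)
      (π (Fin.last (m + 1))) y x) : realizable d (m + 2) π := by
  obtain ⟨L, a, b, s, h1, h2, h3, h4, h5, -, -⟩ := h
  have hL : (L ++ [a, b]).map ct = List.ofFn π := by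
    rw [List.ofFn_succ', List.ofFn_succ', List.map_append, h1, ← h2, ← h3]
    simp
  obtain ⟨α, hα⟩ := exists_ofFn_eq (k := m + 2) (L := L ++ [a, b]) (by
    simpa using congrArg List.length hL)
  refine ⟨α, fun i => ?_, by rw [hα]; simpa [mul_assoc] using h4, fun u v => ?_⟩
  · rw [← hα, List.map_ofFn] at hL
    rw [← ct_eq_fullCycleType]
    exact congrFun (List.ofFn_injective hL) i
  · have hT : Tr (L ++ [a, b]) := h5.mono fun f hf => by
      simp only [List.mem_append, List.mem_cons] at hf ⊢
      rintro c (rfl | rfl | hc)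
      exacts [hf c (by simp), hf c (by simp), hf c (by simp [hc])]
    have := hT.exists_mem_closure u v
    rwa [← hα, show {σ | σ ∈ List.ofFn α} = Set.range α by
      ext; rw [Set.mem_ofPred_eq, List.mem_ofFn]; rfl] at this

theorem realizable_of_card_le {d m : ℕ} (hd : 1 ≤ d) {π : Fin (m + 2) → Multiset ℕ}
    (hpart : ∀ i, Part d (π i)) (hπ : ∀ i, 1 ≤ nu (π i)) (hsum : ∑ i, nu (π i) = 2 * d - 2)
    (hcard : (π (Fin.last (m + 1))).card ≤ m) : realizable d (m + 2) π := by
  obtain ⟨y, hy⟩ := (hpart (Fin.last m).castSucc).exists_mem hd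
  obtain ⟨x, hx⟩ := (hpart (Fin.last (m + 1))).exists_mem hd
  refine realizable_of_meet (Adm.meet (y := y) (x := x) ⟨?_, hpart _, hpart _, ?_, hπ _, ?_, ?_⟩
    hy hx)
  · simp only [List.mem_ofFn]
    rintro _ ⟨i, rfl⟩
    exact hpart _
  · simp only [List.mem_ofFn]
    rintro _ ⟨i, rfl⟩
    exact hπ _
  · rw [Fin.sum_univ_castSucc, Fin.sum_univ_castSucc] at hsum
    have := (hpart (Fin.last (m + 1))).nu_add_card
    rw [List.map_ofFn, List.sum_ofFn]
    simp only [Function.comp_apply]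
    omega
  · simpa using hcard

lemma one_le_nu_of_mem {M : Multiset ℕ} {a : ℕ} (h : a ∈ M) (ha : 1 < a) : 1 ≤ nu M := by
  have := le_nu_of_mem h
  omega

end Realizable

end Hurwitz

theorem stmt0 (k d : ℕ) (hk : 3 ≤ k) (hd : 3 ≤ d)
    (π : Fin k → Multiset ℕ)
    (hpart : ∀ i, (π i).sum = d ∧ (∀ a ∈ π i, 1 ≤ a) ∧ ∃ a ∈ π i, 1 < a)
    (hRH : ∑ i, (d - Multiset.card (π i)) = 2 * d - 2)
    (hmin : ∀ i, Multiset.card (π ⟨k - 1, by omega⟩) ≤ Multiset.card (π i))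
    (hk2 : Multiset.card (π ⟨k - 1, by omega⟩) + 2 ≤ k) :
    realizable d k π := by
  obtain ⟨m, rfl⟩ : ∃ m, k = m + 2 := ⟨k - 2, by omega⟩
  have hπ : ∀ i, Hurwitz.Part d (π i) := fun i => ⟨(hpart i).2.1, (hpart i).1⟩
  refine Hurwitz.realizable_of_card_le (by omega) hπ (fun i => ?_) ?_ ?_
  · obtain ⟨a, ha, ha1⟩ := (hpart i).2.2
    exact Hurwitz.one_le_nu_of_mem ha ha1
  · rw [← hRH]
    refine Finset.sum_congr rfl fun i _ => ?_
    have := (hπ i).nu_add_card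
    omega
  · have : (⟨m + 2 - 1, by omega⟩ : Fin (m + 2)) = Fin.last (m + 1) := rfl
    rw [this] at hk2
    omega
end

section
/- Suppose d = d′·d″ where d′ is the minimal prime factor of d and d″ > 2. Consider the collection D of k = d″ + 1 partitions of d consisting of: two copies of the partition [d′, …, d′] with d″ parts all equal to d′; one copy of the partition [d″ + 1, 1, …, 1] with one part d″ + 1 and d − d″ − 1 parts equal to 1; and d″ − 2 copies of the partition [2, 1, …, 1] with one part 2 and d − 2 parts equal to 1. Then D is not realizable: there do not exist permutations α_1, …, α_{d″+1} of {1, …, d} whose cycle types (counting fixed points as parts equal to 1) are these partitions, whose product is the identity, and which generate a subgroup acting transitively on {1, …, d}. -/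
open Module

section Cohomology

variable (F : Type*) [Field F] {X : Type*}

/-- The operator `f ↦ f ∘ σ - f` on functions `X → F`. -/
def permDiff (σ : Equiv.Perm X) : (X → F) →ₗ[F] (X → F) :=
  LinearMap.funLeft F F σ - LinearMap.id

variable {F}

@[simp]
theorem permDiff_apply (σ : Equiv.Perm X) (f : X → F) (x : X) :
    permDiff F σ f x = f (σ x) - f x := rfl

theorem finrank_range_permDiff_mul_le [Finite X] (σ τ : Equiv.Perm X) :
    finrank F (LinearMap.range (permDiff F (σ * τ))) ≤
      finrank F (LinearMap.range (permDiff F σ)) + finrank F (LinearMap.range (permDiff F τ)) := by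
  have h : permDiff F (σ * τ) =
      (LinearMap.funLeft F F τ) ∘ₗ permDiff F σ + permDiff F τ := by
    ext f x
    simp [permDiff, LinearMap.funLeft]
  have hle : LinearMap.range (permDiff F (σ * τ)) ≤
      (LinearMap.range (permDiff F σ)).map (LinearMap.funLeft F F τ) ⊔
        LinearMap.range (permDiff F τ) := by
    rintro _ ⟨f, rfl⟩
    rw [h]
    exact Submodule.add_mem_sup ⟨_, ⟨f, rfl⟩, rfl⟩ ⟨f, rfl⟩
  exact (Submodule.finrank_mono hle).trans <|
    (Submodule.finrank_add_le_finrank_add_finrank _ _).trans <|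
      Nat.add_le_add_right (Submodule.finrank_map_le _ _) _

theorem finrank_span_singleton_le_one {V : Type*} [AddCommGroup V] [Module F V] (v : V) :
    finrank F (F ∙ v) ≤ 1 := by
  have h := finrank_span_finset_le_card (R := F) ({v} : Finset V)
  rwa [Finset.coe_singleton] at h

theorem finrank_range_permDiff_swap_le [Finite X] [DecidableEq X] (a b : X) :
    finrank F (LinearMap.range (permDiff F (Equiv.swap a b))) ≤ 1 := by
  refine (Submodule.finrank_mono (t := F ∙ (Pi.single a 1 - Pi.single b 1 : X → F)) ?_).trans
    (finrank_span_singleton_le_one _)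
  rintro _ ⟨f, rfl⟩
  refine Submodule.mem_span_singleton.2 ⟨f b - f a, ?_⟩
  ext x
  by_cases ha : x = a
  · subst ha
    by_cases hb : x = b
    · subst hb; simp
    · simp [hb]
  · by_cases hb : x = b
    · subst hb; simp [ha]
    · simp [ha, hb, Equiv.swap_apply_of_ne_of_ne ha hb]

theorem Equiv.Perm.IsCycle.finrank_range_permDiff_lt [Fintype X] [DecidableEq X]
    {σ : Equiv.Perm X} (hσ : σ.IsCycle) :
    finrank F (LinearMap.range (permDiff F σ)) < σ.support.card := by
  induction hn : σ.support.card using Nat.strong_induction_on generalizing σ with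
  | _ n ih =>
    obtain ⟨x, hx, -⟩ := id hσ
    by_cases hxx : σ (σ x) = x
    · have h := hσ.eq_swap_of_apply_apply_eq_self hx hxx
      have h2 := hσ.two_le_card_support
      have := finrank_range_permDiff_swap_le (F := F) x (σ x)
      rw [← h] at this
      omega
    · have hc := hσ.swap_mul hx hxx
      have hs : (Equiv.swap x (σ x) * σ).support.card < σ.support.card :=
        Equiv.Perm.card_support_swap_mul hx
      have h1 := ih _ (hn ▸ hs) hc rfl
      have h2 := finrank_range_permDiff_mul_le (F := F) (Equiv.swap x (σ x))
        (Equiv.swap x (σ x) * σ)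
      rw [Equiv.swap_mul_self_mul] at h2
      have := finrank_range_permDiff_swap_le (F := F) x (σ x)
      omega

theorem finrank_range_permDiff_add_card_cycleType_le [Fintype X] [DecidableEq X]
    (σ : Equiv.Perm X) :
    finrank F (LinearMap.range (permDiff F σ)) + σ.cycleType.card ≤ σ.cycleType.sum := by
  induction σ using Equiv.Perm.cycle_induction_on with
  | base_one =>
    have : permDiff F (1 : Equiv.Perm X) = 0 := by ext; simp [permDiff, LinearMap.funLeft]
    simp [this]
  | base_cycles σ hσ =>
    have := hσ.finrank_range_permDiff_lt (F := F)
    simp [hσ.cycleType]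
    omega
  | induction_disjoint σ τ hd _ h1 h2 =>
    have := finrank_range_permDiff_mul_le (F := F) σ τ
    simp [hd.cycleType_mul]
    omega

theorem comp_perm_sub_mem_of_mem_closure {s : Set (Equiv.Perm X)} {W : Submodule F (X → F)}
    (h : ∀ σ ∈ s, ∀ f : X → F, f ∘ σ - f ∈ W) {g : Equiv.Perm X}
    (hg : g ∈ Subgroup.closure s) (f : X → F) : f ∘ g - f ∈ W := by
  induction hg using Subgroup.closure_induction generalizing f with
  | mem σ hσ => exact h σ hσ f
  | one => simp
  | mul σ τ _ _ h1 h2 =>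
    have := W.add_mem (h2 (f ∘ σ)) (h1 f)
    rwa [sub_add_sub_cancel, Function.comp_assoc, ← Equiv.Perm.coe_mul] at this
  | inv σ _ h1 =>
    have := W.neg_mem (h1 (f ∘ ⇑σ⁻¹))
    rwa [neg_sub, Function.comp_assoc, ← Equiv.Perm.coe_mul, inv_mul_cancel,
      Equiv.Perm.coe_one, Function.comp_id] at this

theorem comp_perm_eq_of_mem_closure {Y : Type*} {s : Set (Equiv.Perm X)} {f : X → Y}
    (h : ∀ σ ∈ s, ∀ x, f (σ x) = f x) {g : Equiv.Perm X}
    (hg : g ∈ Subgroup.closure s) (x : X) : f (g x) = f x := by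
  induction hg using Subgroup.closure_induction generalizing x with
  | mem σ hσ => exact h σ hσ x
  | one => simp
  | mul σ τ _ _ h1 h2 => rw [Equiv.Perm.mul_apply, h1, h2]
  | inv σ _ h1 => simpa using (h1 (σ⁻¹ x)).symm

variable {k : ℕ}

/-- The product of the permutations `α i, α (i + 1), …`. -/
def suffixProd (α : Fin k → Equiv.Perm X) (i : ℕ) : Equiv.Perm X :=
  ((List.ofFn α).drop i).prod

theorem suffixProd_eq_mul (α : Fin k → Equiv.Perm X) (i : Fin k) :
    suffixProd α i = α i * suffixProd α (i + 1) := by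
  unfold suffixProd
  rw [List.drop_eq_getElem_cons (by simp)]
  simp

/-- The cocycle relation attached to the product of the permutations `α i`, as a linear map on
tuples of functions which are coboundaries for each `α i` separately. -/
noncomputable def cocycleMap (α : Fin k → Equiv.Perm X) :
    ((i : Fin k) → LinearMap.range (permDiff F (α i))) →ₗ[F] (X → F) :=
  ∑ i : Fin k, LinearMap.funLeft F F (suffixProd α (i + 1)) ∘ₗ
    (LinearMap.range (permDiff F (α i))).subtype ∘ₗ LinearMap.proj i

theorem cocycleMap_apply (α : Fin k → Equiv.Perm X)
    (w : (i : Fin k) → LinearMap.range (permDiff F (α i))) :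
    cocycleMap α w = ∑ i : Fin k, (w i : X → F) ∘ suffixProd α (i + 1) := by
  simp only [cocycleMap, LinearMap.sum_apply]
  rfl

/-- The tuple of coboundaries of a function. -/
def coboundaryMap (α : Fin k → Equiv.Perm X) :
    (X → F) →ₗ[F] ((i : Fin k) → LinearMap.range (permDiff F (α i))) :=
  LinearMap.pi fun i => (permDiff F (α i)).rangeRestrict

theorem cocycleMap_coboundaryMap {α : Fin k → Equiv.Perm X} (hα : (List.ofFn α).prod = 1)
    (f : X → F) : cocycleMap α (coboundaryMap α f) = 0 := by
  rw [cocycleMap_apply]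
  have h (i : Fin k) : (coboundaryMap α f i : X → F) ∘ suffixProd α (i + 1) =
      f ∘ suffixProd α i - f ∘ suffixProd α (i + 1) := by
    ext x
    simp [coboundaryMap, suffixProd_eq_mul]
  simp_rw [h]
  rw [Fin.sum_univ_eq_sum_range (fun i => f ∘ suffixProd α i - f ∘ suffixProd α (i + 1)),
    Finset.sum_range_sub']
  simp [suffixProd, hα, List.drop_of_length_le]

variable [Fintype X] {α : Fin k → Equiv.Perm X}

theorem card_le_finrank_range_cocycleMap_add_one (hα : (List.ofFn α).prod = 1)
    (htrans : ∀ x y : X, ∃ g ∈ Subgroup.closure (Set.range α), g x = y) :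
    Fintype.card X ≤ finrank F (LinearMap.range (cocycleMap (F := F) α)) + 1 := by
  classical
  set W := LinearMap.range (cocycleMap (F := F) α)
  have hstep (i : Fin k) (f : X → F) :
      f ∘ suffixProd α i - f ∘ suffixProd α (i + 1) ∈ W := by
    refine ⟨Pi.single i ⟨permDiff F (α i) f, f, rfl⟩, ?_⟩
    rw [cocycleMap_apply, Finset.sum_eq_single i]
    · ext x; simp [suffixProd_eq_mul]
    · intro j _ hj
      rw [Pi.single_eq_of_ne hj]; rfl
    · simp
  have hsuff (f : X → F) (i : ℕ) : i ≤ k → f ∘ suffixProd α i - f ∈ W := by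
    induction i with
    | zero => simp [suffixProd, hα]
    | succ i ih =>
      intro hi
      have := W.sub_mem (ih (by omega)) (hstep ⟨i, hi⟩ f)
      simpa using this
  have hgen : ∀ σ ∈ Set.range α, ∀ f : X → F, f ∘ σ - f ∈ W := by
    rintro _ ⟨i, rfl⟩ f
    have h1 := hsuff f i i.2.le
    have h2 := hsuff (f ∘ α i) (i + 1) i.2
    rw [Function.comp_assoc, ← Equiv.Perm.coe_mul, ← suffixProd_eq_mul] at h2
    simpa using W.sub_mem h1 h2
  rcases isEmpty_or_nonempty X with hX | ⟨⟨x₀⟩⟩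
  · simp
  have htop : W ⊔ (F ∙ (Pi.single x₀ 1 : X → F)) = ⊤ := by
    rw [eq_top_iff, ← (Pi.basisFun F X).span_eq, Submodule.span_le]
    rintro _ ⟨x, rfl⟩
    obtain ⟨g, hg, rfl⟩ := htrans x₀ x
    have h := comp_perm_sub_mem_of_mem_closure hgen hg (Pi.single (g x₀) 1)
    have he : (Pi.single (g x₀) 1 : X → F) ∘ g = Pi.single x₀ 1 := by
      ext y; simp [Pi.single_apply]
    rw [he] at h
    rw [Pi.basisFun_apply]
    have := Submodule.sub_mem _ (Submodule.mem_sup_right (S := W)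
      (Submodule.mem_span_singleton_self (R := F) (Pi.single x₀ 1 : X → F)))
      (Submodule.mem_sup_left h)
    simpa using this
  have h1 := Submodule.finrank_add_le_finrank_add_finrank W (F ∙ (Pi.single x₀ 1 : X → F))
  have h2 := finrank_span_singleton_le_one (F := F) (Pi.single x₀ 1 : X → F)
  rw [htop, finrank_top, finrank_fintype_fun_eq_card] at h1
  omega

theorem card_le_finrank_range_coboundaryMap_add_one
    (htrans : ∀ x y : X, ∃ g ∈ Subgroup.closure (Set.range α), g x = y) :
    Fintype.card X ≤ finrank F (LinearMap.range (coboundaryMap (F := F) α)) + 1 := by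
  have hker : LinearMap.ker (coboundaryMap (F := F) α) ≤ F ∙ (1 : X → F) := by
    intro f hf
    have hinv : ∀ σ ∈ Set.range α, ∀ x, f (σ x) = f x := by
      rintro _ ⟨i, rfl⟩ x
      have := congrFun (congrArg Subtype.val (congrFun (LinearMap.mem_ker.1 hf) i)) x
      exact sub_eq_zero.1 this
    rcases isEmpty_or_nonempty X with hX | ⟨⟨x₀⟩⟩
    · exact (Subsingleton.elim f 0) ▸ Submodule.zero_mem _
    refine Submodule.mem_span_singleton.2 ⟨f x₀, ?_⟩
    ext x
    obtain ⟨g, hg, rfl⟩ := htrans x₀ x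
    simp [comp_perm_eq_of_mem_closure hinv hg]
  have h1 := (coboundaryMap (F := F) α).finrank_range_add_finrank_ker
  have h2 := (Submodule.finrank_mono hker).trans (finrank_span_singleton_le_one _)
  rw [finrank_fintype_fun_eq_card] at h1
  omega

/-- Vanishing of the first cohomology of a genus zero branched covering: if the Riemann-Hurwitz
count gives genus zero, every cocycle that is locally a coboundary is a coboundary. -/
theorem exists_coboundary_eq (hα : (List.ofFn α).prod = 1)
    (htrans : ∀ x y : X, ∃ g ∈ Subgroup.closure (Set.range α), g x = y)
    (hgenus : ∑ i, finrank F (LinearMap.range (permDiff F (α i))) + 2 ≤ 2 * Fintype.card X)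
    (w : Fin k → X → F) (hw : ∀ i, w i ∈ LinearMap.range (permDiff F (α i)))
    (hcocycle : ∑ i : Fin k, w i ∘ suffixProd α (i + 1) = 0) :
    ∃ h : X → F, ∀ i x, h (α i x) - h x = w i x := by
  have hle : LinearMap.range (coboundaryMap (F := F) α) ≤
      LinearMap.ker (cocycleMap (F := F) α) := by
    rintro _ ⟨f, rfl⟩
    exact cocycleMap_coboundaryMap hα f
  have h1 := card_le_finrank_range_cocycleMap_add_one (F := F) hα htrans
  have h2 := card_le_finrank_range_coboundaryMap_add_one (F := F) htrans
  have h3 := (cocycleMap (F := F) α).finrank_range_add_finrank_ker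
  rw [finrank_pi_fintype] at h3
  have heq := Submodule.eq_of_le_of_finrank_le hle (by omega)
  have hmem : (fun i => ⟨w i, hw i⟩ : (i : Fin k) → LinearMap.range (permDiff F (α i))) ∈
      LinearMap.ker (cocycleMap (F := F) α) := by
    rw [LinearMap.mem_ker, cocycleMap_apply, ← hcocycle]
  rw [← heq] at hmem
  obtain ⟨h, hh⟩ := hmem
  exact ⟨h, fun i x => congrFun (congrArg Subtype.val (congrFun hh i)) x⟩

end Cohomology

/-- A fixed-point-free permutation of prime order `p` admits a function to `ZMod p` that it
shifts by one. -/
theorem exists_zmod_apply_perm_eq_add_one {X : Type*} {p : ℕ} (hp : p.Prime)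
    {σ : Equiv.Perm X} (hpow : σ ^ p = 1) (hfix : ∀ x, σ x ≠ x) :
    ∃ h : X → ZMod p, ∀ x, h (σ x) = h x + 1 := by
  have hdvd (x : X) (m : ℤ) (hm : (σ ^ m) x = x) : (p : ℤ) ∣ m := by
    by_contra hnd
    obtain ⟨u, v, huv⟩ := (Nat.prime_iff_prime_int.1 hp).irreducible.coprime_iff_not_dvd.2 hnd
    apply hfix x
    have h1 : σ = (σ ^ m) ^ v := by
      conv_lhs => rw [← zpow_one σ, ← huv, zpow_add, mul_comm u, zpow_mul, zpow_natCast, hpow]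
      rw [one_zpow, one_mul, mul_comm v, zpow_mul]
    rw [h1]
    exact Equiv.Perm.zpow_apply_eq_self_of_apply_eq_self hm v
  let s := Equiv.Perm.SameCycle.setoid σ
  have hrep (x : X) : σ.SameCycle (Quotient.mk s x).out x := Quotient.mk_out (s := s) x
  choose e he using hrep
  refine ⟨fun x => (e x : ZMod p), fun x => ?_⟩
  have hq : Quotient.mk s (σ x) = Quotient.mk s x :=
    Quotient.sound (s := s) (Equiv.Perm.sameCycle_apply_left.2 (Equiv.Perm.SameCycle.refl σ x))
  have h1 := he (σ x)
  rw [hq] at h1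
  have h2 : (σ ^ (e (σ x) - (e x + 1))) (Quotient.mk s x).out = (Quotient.mk s x).out := by
    rw [sub_eq_neg_add, zpow_add, Equiv.Perm.mul_apply, h1, zpow_neg, Equiv.Perm.inv_eq_iff_eq,
      add_comm, zpow_add, Equiv.Perm.mul_apply, he, zpow_one]
  have h3 := (ZMod.intCast_zmod_eq_zero_iff_dvd _ _).2 (hdvd _ _ h2)
  push_cast at h3
  exact sub_eq_zero.1 h3

theorem card_fullCycleType {d : ℕ} (σ : Equiv.Perm (Fin d)) :
    (fullCycleType σ).card + σ.cycleType.sum = σ.cycleType.card + d := by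
  have : σ.cycleType.sum ≤ d := by
    simpa using σ.sum_cycleType.le.trans (Finset.card_le_univ _)
  simp [fullCycleType]
  omega

theorem filter_fullCycleType {d : ℕ} (σ : Equiv.Perm (Fin d)) :
    (fullCycleType σ).filter (2 ≤ ·) = σ.cycleType := by
  rw [fullCycleType, Multiset.filter_add, Multiset.filter_eq_self.2 fun _ h =>
    Equiv.Perm.two_le_of_mem_cycleType h, Multiset.filter_eq_nil.2, add_zero]
  intro a ha
  rw [Multiset.eq_of_mem_replicate ha]
  omega

theorem finrank_range_permDiff_add_card_fullCycleType_le (F : Type*) [Field F] {d : ℕ}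
    (σ : Equiv.Perm (Fin d)) :
    finrank F (LinearMap.range (permDiff F σ)) + (fullCycleType σ).card ≤ d := by
  have h1 := finrank_range_permDiff_add_card_cycleType_le (F := F) σ
  have h2 := card_fullCycleType σ
  omega

theorem exists_zmod_apply_eq_add_one_of_fullCycleType {p n : ℕ} (hp : p.Prime)
    {σ : Equiv.Perm (Fin (p * n))} (hσ : fullCycleType σ = Multiset.replicate n p) :
    ∃ h : Fin (p * n) → ZMod p, ∀ x, h (σ x) = h x + 1 := by
  have hct : σ.cycleType = Multiset.replicate n p := by
    rw [← filter_fullCycleType, hσ, Multiset.filter_eq_self]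
    intro a ha
    rw [Multiset.eq_of_mem_replicate ha]
    exact hp.two_le
  apply exists_zmod_apply_perm_eq_add_one hp
  · rw [← orderOf_dvd_iff_pow_eq_one, ← Equiv.Perm.lcm_cycleType, hct, Multiset.lcm_dvd]
    intro a ha
    rw [Multiset.eq_of_mem_replicate ha]
  · have hs : σ.support = Finset.univ := by
      rw [← Finset.card_eq_iff_eq_univ, ← Equiv.Perm.sum_cycleType, hct]
      simp [mul_comm]
    intro x
    rw [← Equiv.Perm.mem_support, hs]
    exact Finset.mem_univ x

/-- The support of a cycle lying in one fibre of a map to `ZMod p` that another permutation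
shifts by one has at most `|X| / p` elements. -/
theorem Equiv.Perm.IsCycle.card_support_mul_le {X : Type*} [Fintype X] [DecidableEq X] {p : ℕ}
    [NeZero p] {σ τ : Equiv.Perm X} (hτ : τ.IsCycle) {h : X → ZMod p}
    (hσ : ∀ x, h (σ x) = h x + 1) (hinv : ∀ x, h (τ x) = h x) :
    τ.support.card * p ≤ Fintype.card X := by
  have hpow (n : ℕ) (x : X) : h ((σ ^ n) x) = h x + n := by
    induction n with
    | zero => simp
    | succ n ih =>
      rw [pow_succ', Equiv.Perm.mul_apply, hσ, ih]
      push_cast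
      ring
  have hconst {x y : X} (hx : x ∈ τ.support) (hy : y ∈ τ.support) : h x = h y := by
    obtain ⟨n, rfl⟩ := hτ.exists_zpow_eq (Equiv.Perm.mem_support.1 hx)
      (Equiv.Perm.mem_support.1 hy)
    refine (comp_perm_eq_of_mem_closure (s := {τ}) ?_ ?_ x).symm
    · rintro _ rfl
      exact hinv
    · exact zpow_mem (Subgroup.mem_closure_singleton_self τ) n
  have hinj : Function.Injective fun q : τ.support × ZMod p => (σ ^ q.2.val) (q.1 : X) := by
    rintro ⟨x, i⟩ ⟨y, j⟩ hxy
    have hij := congrArg h hxy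
    simp only [hpow, hconst x.2 y.2, ZMod.natCast_val, ZMod.cast_id', id, add_right_inj] at hij
    subst hij
    exact Prod.ext (Subtype.ext ((σ ^ i.val).injective hxy)) rfl
  have hcard := Fintype.card_le_of_injective _ hinj
  rwa [Fintype.card_prod, Fintype.card_coe, ZMod.card] at hcard

/-- The collection consisting of two copies of `[d', …, d']` (with `d''` parts equal to `d'`),
one copy of `[d''+1, 1, …, 1]`, and `d'' - 2` copies of `[2, 1, …, 1]` is not realizable. -/
theorem stmt2 (d d' d'' : ℕ)
    (hfac : d = d' * d'')
    (hprime : d'.Prime)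
    (hminfac : ∀ p : ℕ, p.Prime → p ∣ d → d' ≤ p)
    (hd'' : 2 < d'')
    (D : Fin (d'' + 1) → Multiset ℕ)
    (hD : ∀ i : Fin (d'' + 1), D i =
      if i.val ≤ 1 then Multiset.replicate d'' d'
      else if i.val = 2 then (d'' + 1) ::ₘ Multiset.replicate (d - (d'' + 1)) 1
      else 2 ::ₘ Multiset.replicate (d - 2) 1) :
    ¬ realizable d (d'' + 1) D := by
  rintro ⟨α, hct, hprod, htrans⟩
  subst hfac
  have hp2 := hprime.two_le
  have : Fact d'.Prime := ⟨hprime⟩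
  have : NeZero d' := ⟨hprime.ne_zero⟩
  simp_rw [hD] at hct
  obtain ⟨m, rfl⟩ : ∃ m, d'' = m + 3 := ⟨d'' - 3, by omega⟩
  have hn : 2 * (m + 3) ≤ d' * (m + 3) := Nat.mul_le_mul_right _ hp2
  have hct0 := hct 0
  have hct1 := hct 1
  have hct2 := hct 2
  simp only [show ((0 : Fin (m + 3 + 1)) : ℕ) = 0 from rfl] at hct0
  simp only [show ((1 : Fin (m + 3 + 1)) : ℕ) = 1 from rfl] at hct1
  simp only [show ((2 : Fin (m + 3 + 1)) : ℕ) = 2 from rfl] at hct2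
  norm_num at hct0 hct1 hct2
  have hrank (i : Fin (m + 3 + 1)) :
      finrank (ZMod d') (LinearMap.range (permDiff (ZMod d') (α i))) ≤
        if i.val ≤ 1 then d' * (m + 3) - (m + 3) else if i.val = 2 then m + 3 else 1 := by
    have h := finrank_range_permDiff_add_card_fullCycleType_le (ZMod d') (α i)
    rw [hct] at h
    split_ifs at h ⊢ <;> simp at h <;> omega
  obtain ⟨h₀, hh₀⟩ := exists_zmod_apply_eq_add_one_of_fullCycleType hprime hct0
  obtain ⟨h₁, hh₁⟩ := exists_zmod_apply_eq_add_one_of_fullCycleType hprime hct1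
  let c : Fin (m + 3 + 1) → ZMod d' := Fin.cons 1 (Fin.cons (-1) 0)
  obtain ⟨h, hh⟩ := exists_coboundary_eq (F := ZMod d') hprod htrans (by
      have := Finset.sum_le_sum fun i (_ : i ∈ Finset.univ) => hrank i
      simp only [Fin.sum_univ_succ (n := m + 3), Fin.sum_univ_succ (n := m + 2),
        Fin.sum_univ_succ (n := m + 1)] at this ⊢
      simp [Nat.mod_eq_of_lt (show 2 < m + 3 + 1 by omega)] at this ⊢
      omega)
    (fun i _ => c i) (by
      intro i
      refine Fin.cases ?_ (fun i => Fin.cases ?_ (fun i => ?_) i) i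
      · exact ⟨h₀, by ext x; simp [hh₀, c]⟩
      · exact ⟨-h₁, by ext x; simp [hh₁, c]⟩
      · exact ⟨0, by ext x; simp [c]⟩)
    (by
      ext x
      simp [c, Fin.sum_univ_succ])
  have hcyc : (α 2).cycleType = {m + 3 + 1} := by
    rw [← filter_fullCycleType, hct2, Multiset.filter_cons_of_pos _ (by omega),
      Multiset.filter_eq_nil.2]
    · rfl
    · intro a ha
      rw [Multiset.eq_of_mem_replicate ha]
      omega
  have hcycle : (α 2).IsCycle := by
    rw [← Equiv.Perm.card_cycleType_eq_one, hcyc, Multiset.card_singleton]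
  have hle := hcycle.card_support_mul_le (σ := α 0) (h := h)
    (fun x => by rw [← sub_eq_iff_eq_add']; exact hh 0 x)
    (fun x => sub_eq_zero.1 (hh 2 x))
  rw [← Equiv.Perm.sum_cycleType, hcyc, Multiset.sum_singleton, Fintype.card_fin] at hle
  nlinarith
end
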